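/- Let 4/3<α≤6, θ:=1−α/2, and let 2≤r<∞ with conjugate exponent r':=r/(r−1). There exists a constant C>0 depending only on α and r such that for every Schwartz function u₀∈𝒮(ℝ²) and every t∈ℝ with t≠0, the function v_r(x,y) := ∫_{ℝ²} e^{i(xξ+yη)} |ξ|^{(2/r−1)θ} e^{it(ξ|ξ|^α − η²/ξ)} û₀(ξ,η) dξ dη (an absolutely convergent integral) satisfies ‖v_r‖_{L^r(ℝ²)} ≤ C·|t|^{2/r−1}·‖u₀‖_{L^{r'}(ℝ²)}. -/

import Mathlib

open Real MeasureTheory Complex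

/-- Non-stationary phase: one integration by parts, with the error term controlled by the
derivative of an explicit function `B`. -/
lemma norm_oscillatory_integral_le {a b : ℝ} (hab : a ≤ b) {φ D D' B B' : ℝ → ℝ} {A A' : ℝ → ℂ}
    (hφ : ∀ x ∈ Set.Icc a b, HasDerivAt φ (D x) x)
    (hD : ∀ x ∈ Set.Icc a b, HasDerivAt D (D' x) x)
    (hA : ∀ x ∈ Set.Icc a b, HasDerivAt A (A' x) x)
    (hB : ∀ x ∈ Set.Icc a b, HasDerivAt B (B' x) x)
    (hD0 : ∀ x ∈ Set.Icc a b, D x ≠ 0)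
    (hD' : ContinuousOn D' (Set.Icc a b)) (hA' : ContinuousOn A' (Set.Icc a b))
    (hB' : ContinuousOn B' (Set.Icc a b))
    (hle : ∀ x ∈ Set.Icc a b, ‖A' x‖ / |D x| + ‖A x‖ * |D' x| / D x ^ 2 ≤ B' x) :
    ‖∫ x in a..b, cexp (I * φ x) * A x‖ ≤
      ‖A a‖ / |D a| + ‖A b‖ / |D b| + (B b - B a) := by
  have hφc : ContinuousOn φ (Set.Icc a b) := fun x hx => (hφ x hx).continuousAt.continuousWithinAt
  have hDc : ContinuousOn D (Set.Icc a b) := fun x hx => (hD x hx).continuousAt.continuousWithinAt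
  have hAc : ContinuousOn A (Set.Icc a b) := fun x hx => (hA x hx).continuousAt.continuousWithinAt
  have hDcc : ContinuousOn (fun x => (D x : ℂ)) (Set.Icc a b) :=
    Complex.continuous_ofReal.comp_continuousOn hDc
  have hDcc' : ContinuousOn (fun x => (D' x : ℂ)) (Set.Icc a b) :=
    Complex.continuous_ofReal.comp_continuousOn hD'
  have hE : ContinuousOn (fun x => cexp (I * φ x)) (Set.Icc a b) :=
    (continuousOn_const.mul (Complex.continuous_ofReal.comp_continuousOn hφc)).cexp
  have hDne : ∀ x ∈ Set.Icc a b, (D x : ℂ) ≠ 0 := fun x hx => by exact_mod_cast hD0 x hx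
  have hIne : (I : ℂ) ≠ 0 := I_ne_zero
  set R : ℝ → ℂ := fun x => cexp (I * φ x) * (A' x / (I * D x) - A x * D' x / (I * (D x) ^ 2))
    with hR
  have hRc : ContinuousOn R (Set.Icc a b) := by
    refine hE.mul ((hA'.div (continuousOn_const.mul hDcc) ?_).sub
      ((hAc.mul hDcc').div (continuousOn_const.mul (hDcc.pow 2)) ?_))
    · intro x hx; exact mul_ne_zero hIne (hDne x hx)
    · intro x hx; exact mul_ne_zero hIne (pow_ne_zero 2 (hDne x hx))
  have hu : Set.uIcc a b = Set.Icc a b := Set.uIcc_of_le hab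
  have hEA : ContinuousOn (fun x => cexp (I * φ x) * A x) (Set.Icc a b) := hE.mul hAc
  have hEAi : IntervalIntegrable (fun x => cexp (I * φ x) * A x) volume a b :=
    (hu ▸ hEA).intervalIntegrable
  have hRi : IntervalIntegrable R volume a b := (hu ▸ hRc).intervalIntegrable
  have hB'i : IntervalIntegrable B' volume a b := (hu ▸ hB').intervalIntegrable
  have hder : ∀ x ∈ Set.uIcc a b, HasDerivAt (fun x => cexp (I * φ x) * (A x / (I * D x)))
      (cexp (I * φ x) * A x + R x) x := by
    intro x hx
    rw [hu] at hx
    have h1 : HasDerivAt (fun x => cexp (I * φ x)) (cexp (I * φ x) * (I * D x)) x :=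
      ((hφ x hx).ofReal_comp.const_mul I).cexp
    have h2 : HasDerivAt (fun x => I * (D x : ℂ)) (I * D' x) x :=
      (hD x hx).ofReal_comp.const_mul I
    have h3 := h1.mul ((hA x hx).div h2 (mul_ne_zero hIne (hDne x hx)))
    refine h3.congr_deriv ?_
    have := hDne x hx
    simp only [hR, Pi.div_apply]
    field_simp
  have hint := intervalIntegral.integral_eq_sub_of_hasDerivAt hder (hEAi.add hRi)
  rw [intervalIntegral.integral_add hEAi hRi] at hint
  have hRle : ‖∫ x in a..b, R x‖ ≤ B b - B a := by
    rw [← intervalIntegral.integral_eq_sub_of_hasDerivAt (hu ▸ hB) hB'i]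
    refine intervalIntegral.norm_integral_le_of_norm_le hab (ae_of_all _ fun x hx => ?_) hB'i
    have hx' : x ∈ Set.Icc a b := Set.Ioc_subset_Icc_self hx
    refine le_trans ?_ (hle x hx')
    simp only [hR, norm_mul, norm_exp_I_mul_ofReal, one_mul]
    refine (norm_sub_le _ _).trans (le_of_eq ?_)
    simp
  have hval : ∀ x, ‖cexp (I * φ x) * (A x / (I * D x))‖ = ‖A x‖ / |D x| := by
    intro x
    simp [norm_exp_I_mul_ofReal]
  calc ‖∫ x in a..b, cexp (I * φ x) * A x‖
      = ‖cexp (I * φ b) * (A b / (I * D b)) - cexp (I * φ a) * (A a / (I * D a))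
          - ∫ x in a..b, R x‖ := by rw [← hint]; congr 1; ring
    _ ≤ ‖cexp (I * φ b) * (A b / (I * D b))‖ + ‖cexp (I * φ a) * (A a / (I * D a))‖
          + ‖∫ x in a..b, R x‖ := (norm_sub_le _ _).trans (by gcongr; exact norm_sub_le _ _)
    _ ≤ _ := by rw [hval, hval]; linarith

lemma hasDerivAt_cexp_mul_log_sub (c : ℂ) (b : ℝ) {x : ℝ} (hx : 0 < x) :
    HasDerivAt (fun x : ℝ => cexp (c * (Real.log x : ℂ) - b * x))
      (cexp (c * (Real.log x : ℂ) - b * x) * (c * (x⁻¹ : ℝ) - b)) x := by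
  have h1 : HasDerivAt (fun x : ℝ => c * (Real.log x : ℂ)) (c * (x⁻¹ : ℝ)) x :=
    (Real.hasDerivAt_log hx.ne').ofReal_comp.const_mul c
  have h2 : HasDerivAt (fun x : ℝ => (b : ℂ) * (x : ℂ)) (b * (1 : ℝ)) x :=
    (hasDerivAt_id x).ofReal_comp.const_mul (b : ℂ)
  simpa using (h1.sub h2).cexp

lemma norm_cexp_mul_log_sub (c : ℂ) (b : ℝ) {x : ℝ} (hx : 0 < x) :
    ‖cexp (c * (Real.log x : ℂ) - b * x)‖ = x ^ c.re * rexp (-(b * x)) := by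
  rw [Complex.norm_exp, Real.rpow_def_of_pos hx, ← Real.exp_add]
  congr 1
  simp
  ring

lemma norm_cexp_mul_log_sub_le (c : ℂ) {b : ℝ} (hb : 0 ≤ b) {x : ℝ} (hx : 0 < x) :
    ‖cexp (c * (Real.log x : ℂ) - b * x)‖ ≤ x ^ c.re := by
  rw [norm_cexp_mul_log_sub c b hx]
  have : rexp (-(b * x)) ≤ 1 := Real.exp_le_one_iff.2 (by simpa using mul_nonneg hb hx.le)
  exact mul_le_of_le_one_right (by positivity) this

lemma norm_deriv_cexp_mul_log_sub_le (c : ℂ) {b : ℝ} (hb : 0 ≤ b) {x : ℝ} (hx : 0 < x) :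
    ‖cexp (c * (Real.log x : ℂ) - b * x) * (c * (x⁻¹ : ℝ) - b)‖ ≤ (‖c‖ + 1) * x ^ c.re / x := by
  rw [norm_mul, norm_cexp_mul_log_sub c b hx]
  have hbx : 0 ≤ b * x := mul_nonneg hb hx.le
  have h0 : rexp (-(b * x)) ≤ 1 := Real.exp_le_one_iff.2 (by simpa using hbx)
  have h1 : rexp (-(b * x)) * (b * x) ≤ 1 := by
    rw [Real.exp_neg, inv_mul_le_one₀ (Real.exp_pos _)]
    linarith [Real.add_one_le_exp (b * x)]
  have h2 : ‖c * (x⁻¹ : ℝ) - b‖ ≤ ‖c‖ / x + b := by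
    refine (norm_sub_le _ _).trans (le_of_eq ?_)
    rw [norm_mul, Complex.norm_real, Complex.norm_real, Real.norm_of_nonneg (by positivity),
      Real.norm_of_nonneg hb]
    ring
  calc x ^ c.re * rexp (-(b * x)) * ‖c * (x⁻¹ : ℝ) - b‖
      ≤ x ^ c.re * rexp (-(b * x)) * (‖c‖ / x + b) := by gcongr
    _ = x ^ c.re / x * (rexp (-(b * x)) * ‖c‖ + rexp (-(b * x)) * (b * x)) := by field_simp
    _ ≤ x ^ c.re / x * (1 * ‖c‖ + 1) := by gcongr
    _ = _ := by ring

lemma mul_sub_le_rpow_sub_rpow {α σ x : ℝ} (hα : 1 ≤ α) (hσ : 0 < σ) (hx : σ ≤ x) :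
    x ^ (α - 1) * (x - σ) ≤ x ^ α - σ ^ α := by
  have hx0 : 0 < x := hσ.trans_le hx
  have e1 : x ^ α = x ^ (α - 1) * x := by
    rw [← Real.rpow_add_one hx0.ne']; ring_nf
  have e2 : σ ^ α = σ ^ (α - 1) * σ := by
    rw [← Real.rpow_add_one hσ.ne']; ring_nf
  have : σ ^ (α - 1) ≤ x ^ (α - 1) := Real.rpow_le_rpow hσ.le hx (by linarith)
  rw [e1, e2]
  nlinarith

lemma rpow_sub_one_eq_sq {α x : ℝ} (hx : 0 < x) : x ^ (α - 1) = (x ^ ((α - 1) / 2)) ^ 2 := by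
  rw [← Real.rpow_natCast, ← Real.rpow_mul hx.le]
  congr 1
  push_cast
  ring

lemma hasDerivAt_phase {α : ℝ} (s : ℝ) {x : ℝ} (hx : 0 < x) :
    HasDerivAt (fun x : ℝ => s * x + x ^ (α + 1)) (s + (α + 1) * x ^ α) x := by
  have h := ((hasDerivAt_id x).const_mul s).add
    (Real.hasDerivAt_rpow_const (p := α + 1) (Or.inl hx.ne'))
  refine h.congr_deriv ?_
  simp

lemma hasDerivAt_deriv_phase {α : ℝ} (s : ℝ) {x : ℝ} (hx : 0 < x) :
    HasDerivAt (fun x : ℝ => s + (α + 1) * x ^ α) ((α + 1) * (α * x ^ (α - 1))) x :=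
  ((Real.hasDerivAt_rpow_const (Or.inl hx.ne')).const_mul (α + 1)).const_add s

lemma continuousOn_amplitude_deriv (c : ℂ) (b : ℝ) {u v : ℝ} (hu : 0 < u) :
    ContinuousOn (fun x : ℝ => cexp (c * (Real.log x : ℂ) - b * x) * (c * (x⁻¹ : ℝ) - b))
      (Set.Icc u v) := by
  have h0 : ∀ x ∈ Set.Icc u v, x ≠ 0 := fun x hx => (hu.trans_le hx.1).ne'
  have hA : ContinuousOn (fun x : ℝ => cexp (c * (Real.log x : ℂ) - b * x)) (Set.Icc u v) :=
    fun x hx => (hasDerivAt_cexp_mul_log_sub c b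
      (hu.trans_le hx.1)).continuousAt.continuousWithinAt
  have hinv : ContinuousOn (fun x : ℝ => ((x⁻¹ : ℝ) : ℂ)) (Set.Icc u v) :=
    Complex.continuous_ofReal.comp_continuousOn (continuousOn_id.inv₀ h0)
  exact hA.mul ((continuousOn_const.mul hinv).sub continuousOn_const)

lemma continuousOn_phase_deriv {α u v : ℝ} (hu : 0 < u) :
    ContinuousOn (fun x : ℝ => (α + 1) * (α * x ^ (α - 1))) (Set.Icc u v) :=
  continuousOn_const.mul (continuousOn_const.mul
    (continuousOn_id.rpow_const fun _ hx => Or.inl (hu.trans_le hx.1).ne'))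

lemma norm_oscillatory_right_le {α σ s b R : ℝ} {c : ℂ} (hα : 1 < α) (hc : c.re = (α - 1) / 2)
    (hb : 0 ≤ b) (hσ : 1 ≤ σ) (hs : -((α + 1) * σ ^ α) ≤ s)
    (hR : σ + (σ ^ ((α - 1) / 2))⁻¹ ≤ R) :
    ‖∫ x in (σ + (σ ^ ((α - 1) / 2))⁻¹)..R, cexp (I * (s * x + x ^ (α + 1) : ℝ)) *
      cexp (c * (Real.log x : ℂ) - b * x)‖ ≤ 3 + ‖c‖ + α := by
  have hσ0 : 0 < σ := by linarith
  set w := σ ^ ((α - 1) / 2) with hw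
  have hw0 : 0 < w := by positivity
  have hin : 0 < w⁻¹ := by positivity
  have hpos : ∀ x ∈ Set.Icc (σ + w⁻¹) R, 0 < x := fun x hx => by linarith [hx.1]
  have hd : ∀ x ∈ Set.Icc (σ + w⁻¹) R, w⁻¹ ≤ x - σ := fun x hx => by linarith [hx.1]
  have hy : ∀ x ∈ Set.Icc (σ + w⁻¹) R, w ≤ x ^ ((α - 1) / 2) := fun _ hx =>
    Real.rpow_le_rpow hσ0.le (by linarith [hx.1]) (by linarith)
  have hD : ∀ x ∈ Set.Icc (σ + w⁻¹) R,
      (x ^ ((α - 1) / 2)) ^ 2 * (x - σ) * (α + 1) ≤ s + (α + 1) * x ^ α := by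
    intro x hx
    have := mul_sub_le_rpow_sub_rpow hα.le hσ0 (show σ ≤ x by linarith [hd x hx])
    rw [rpow_sub_one_eq_sq (hpos x hx)] at this
    nlinarith
  have hDp : ∀ x ∈ Set.Icc (σ + w⁻¹) R, 0 < (x ^ ((α - 1) / 2)) ^ 2 * (x - σ) := by
    intro x hx
    have h1 := hpos x hx
    have : 0 < x - σ := hin.trans_le (hd x hx)
    positivity
  have hDp' : ∀ x ∈ Set.Icc (σ + w⁻¹) R,
      (x ^ ((α - 1) / 2)) ^ 2 * (x - σ) ≤ |s + (α + 1) * x ^ α| := by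
    intro x hx
    refine le_trans ?_ (le_abs_self _)
    nlinarith [hD x hx, hDp x hx]
  have hbd : ∀ x ∈ Set.Icc (σ + w⁻¹) R,
      ‖cexp (c * (Real.log x : ℂ) - b * x)‖ / |s + (α + 1) * x ^ α| ≤ 1 := by
    intro x hx
    have hx0 := hpos x hx
    have h1 := norm_cexp_mul_log_sub_le c hb hx0
    rw [hc] at h1
    have h2 := hDp' x hx
    have h3 := hDp x hx
    rw [div_le_one (h3.trans_le h2)]
    refine h1.trans (le_trans ?_ h2)
    have h4 : 1 ≤ x ^ ((α - 1) / 2) * (x - σ) := by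
      calc 1 = w * w⁻¹ := by field_simp
        _ ≤ _ := mul_le_mul (hy x hx) (hd x hx) hin.le (by positivity)
    have h5 : 0 < x ^ ((α - 1) / 2) := by positivity
    nlinarith
  have key := norm_oscillatory_integral_le hR
    (φ := fun x => s * x + x ^ (α + 1)) (D := fun x => s + (α + 1) * x ^ α)
    (D' := fun x => (α + 1) * (α * x ^ (α - 1)))
    (A := fun x => cexp (c * (Real.log x : ℂ) - b * x))
    (A' := fun x => cexp (c * (Real.log x : ℂ) - b * x) * (c * (x⁻¹ : ℝ) - b))
    (B := fun x => -((‖c‖ + 1 + α) * w⁻¹ * (x - σ)⁻¹))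
    (B' := fun x => (‖c‖ + 1 + α) * w⁻¹ * ((x - σ) ^ 2)⁻¹)
    (fun x hx => hasDerivAt_phase s (hpos x hx))
    (fun x hx => hasDerivAt_deriv_phase s (hpos x hx))
    (fun x hx => hasDerivAt_cexp_mul_log_sub c b (hpos x hx))
    (fun x hx => by
      have h : HasDerivAt (fun x : ℝ => (x - σ)⁻¹) (-1 / (x - σ) ^ 2) x :=
        ((hasDerivAt_id x).sub_const σ).inv (hin.trans_le (hd x hx)).ne'
      refine ((h.const_mul ((‖c‖ + 1 + α) * w⁻¹)).neg).congr_deriv ?_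
      ring)
    (fun x hx => by
      have := (hDp x hx).trans_le (hDp' x hx)
      exact abs_pos.1 this)
    (continuousOn_phase_deriv (by linarith))
    (continuousOn_amplitude_deriv c b (by linarith))
    (by
      refine continuousOn_const.mul (ContinuousOn.inv₀ (by fun_prop) ?_)
      intro x hx
      exact pow_ne_zero 2 (hin.trans_le (hd x hx)).ne')
    (by
      intro x hx
      have hx0 := hpos x hx
      have h1 := norm_cexp_mul_log_sub_le c hb hx0
      have h2 := norm_deriv_cexp_mul_log_sub_le c hb hx0
      rw [hc] at h1 h2
      have h3 := hDp' x hx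
      have h3' : (x ^ ((α - 1) / 2)) ^ 2 * (x - σ) * (α + 1) ≤ |s + (α + 1) * x ^ α| :=
        (hD x hx).trans (le_abs_self _)
      have h4 := hDp x hx
      have h5 := hy x hx
      have h6 : 0 < x - σ := hin.trans_le (hd x hx)
      have h7 : |(α + 1) * (α * x ^ (α - 1))| = (α + 1) * α * (x ^ ((α - 1) / 2)) ^ 2 := by
        rw [rpow_sub_one_eq_sq hx0, abs_of_nonneg (by positivity)]; ring
      have h8 : (s + (α + 1) * x ^ α) ^ 2 = |s + (α + 1) * x ^ α| ^ 2 := (sq_abs _).symm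
      simp only [h7, h8]
      set y := x ^ ((α - 1) / 2) with hyd
      have hy0 : 0 < y := by positivity
      have hinv : y⁻¹ ≤ w⁻¹ := inv_anti₀ hw0 h5
      calc _ ≤ ((‖c‖ + 1) * y / x) / (y ^ 2 * (x - σ))
            + y * ((α + 1) * α * y ^ 2) / ((y ^ 2 * (x - σ)) * (y ^ 2 * (x - σ) * (α + 1))) := by
            gcongr
            rw [sq (|s + (α + 1) * x ^ α|)]
            gcongr
        _ = (‖c‖ + 1) * y⁻¹ * (x⁻¹ * (x - σ)⁻¹) + α * y⁻¹ * ((x - σ) ^ 2)⁻¹ := by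
            field_simp
        _ ≤ (‖c‖ + 1) * w⁻¹ * ((x - σ)⁻¹ * (x - σ)⁻¹) + α * w⁻¹ * ((x - σ) ^ 2)⁻¹ := by
            gcongr
            linarith
        _ = _ := by rw [sq, mul_inv]; ring)
  refine key.trans ?_
  have e1 := hbd (σ + w⁻¹) ⟨le_rfl, hR⟩
  have e2 := hbd R ⟨hR, le_rfl⟩
  have e3 : 0 < (R - σ)⁻¹ := inv_pos.2 (hin.trans_le (hd R ⟨hR, le_rfl⟩))
  have e4 : (‖c‖ + 1 + α) * w⁻¹ * (σ + w⁻¹ - σ)⁻¹ = ‖c‖ + 1 + α := by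
    rw [add_sub_cancel_left, inv_inv]; field_simp
  have e5 : 0 ≤ (‖c‖ + 1 + α) * w⁻¹ * (R - σ)⁻¹ := by positivity
  simp only [e4]
  linarith

lemma norm_oscillatory_left_le {α σ b : ℝ} {c : ℂ} (hα : 1 < α) (hc : c.re = (α - 1) / 2)
    (hb : 0 ≤ b) (hσ : 1 ≤ σ - (σ ^ ((α - 1) / 2))⁻¹) (hσ0 : 0 < σ) :
    ‖∫ x in (1 : ℝ)..(σ - (σ ^ ((α - 1) / 2))⁻¹),
      cexp (I * (-((α + 1) * σ ^ α) * x + x ^ (α + 1) : ℝ)) *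
      cexp (c * (Real.log x : ℂ) - b * x)‖ ≤ 4 + 2 * ‖c‖ + α := by
  set w := σ ^ ((α - 1) / 2) with hw
  have hw0 : 0 < w := by positivity
  have hin : 0 < w⁻¹ := by positivity
  have hσ1 : 1 ≤ σ := by linarith
  have hw1 : 1 ≤ w := Real.one_le_rpow hσ1 (by linarith)
  have hpos : ∀ x ∈ Set.Icc 1 (σ - w⁻¹), 0 < x := fun x hx => by linarith [hx.1]
  have hd : ∀ x ∈ Set.Icc 1 (σ - w⁻¹), w⁻¹ ≤ σ - x := fun x hx => by linarith [hx.2]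
  have hy : ∀ x ∈ Set.Icc 1 (σ - w⁻¹), x ^ ((α - 1) / 2) ≤ w := fun x hx =>
    Real.rpow_le_rpow (hpos x hx).le (by linarith [hd x hx]) (by linarith)
  have hD : ∀ x ∈ Set.Icc 1 (σ - w⁻¹),
      w ^ 2 * (σ - x) * (α + 1) ≤ |-((α + 1) * σ ^ α) + (α + 1) * x ^ α| := by
    intro x hx
    have := mul_sub_le_rpow_sub_rpow hα.le (hpos x hx) (show x ≤ σ by linarith [hd x hx])
    rw [rpow_sub_one_eq_sq hσ0] at this
    refine le_trans ?_ (neg_le_abs _)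
    nlinarith
  have hDp : ∀ x ∈ Set.Icc 1 (σ - w⁻¹), 0 < w ^ 2 * (σ - x) := by
    intro x hx
    have : 0 < σ - x := hin.trans_le (hd x hx)
    positivity
  have hDp' : ∀ x ∈ Set.Icc 1 (σ - w⁻¹),
      w ^ 2 * (σ - x) ≤ |-((α + 1) * σ ^ α) + (α + 1) * x ^ α| := by
    intro x hx
    nlinarith [hD x hx, hDp x hx]
  have hbd : ∀ x ∈ Set.Icc 1 (σ - w⁻¹),
      ‖cexp (c * (Real.log x : ℂ) - b * x)‖ / |-((α + 1) * σ ^ α) + (α + 1) * x ^ α| ≤ 1 := by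
    intro x hx
    have hx0 := hpos x hx
    have h1 := norm_cexp_mul_log_sub_le c hb hx0
    rw [hc] at h1
    have h2 := hDp' x hx
    have h3 := hDp x hx
    rw [div_le_one (h3.trans_le h2)]
    refine h1.trans (le_trans ((hy x hx).trans ?_) h2)
    have h4 : 1 ≤ w * (σ - x) := by
      calc 1 = w * w⁻¹ := by field_simp
        _ ≤ _ := mul_le_mul_of_nonneg_left (hd x hx) hw0.le
    nlinarith
  have key := norm_oscillatory_integral_le hσ
    (φ := fun x => -((α + 1) * σ ^ α) * x + x ^ (α + 1))
    (D := fun x => -((α + 1) * σ ^ α) + (α + 1) * x ^ α)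
    (D' := fun x => (α + 1) * (α * x ^ (α - 1)))
    (A := fun x => cexp (c * (Real.log x : ℂ) - b * x))
    (A' := fun x => cexp (c * (Real.log x : ℂ) - b * x) * (c * (x⁻¹ : ℝ) - b))
    (B := fun x => (‖c‖ + 1 + α) * w⁻¹ * (σ - x)⁻¹ - (‖c‖ + 1) * w⁻¹ * x⁻¹)
    (B' := fun x => (‖c‖ + 1 + α) * w⁻¹ * ((σ - x) ^ 2)⁻¹ + (‖c‖ + 1) * w⁻¹ * (x ^ 2)⁻¹)
    (fun x hx => hasDerivAt_phase _ (hpos x hx))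
    (fun x hx => hasDerivAt_deriv_phase _ (hpos x hx))
    (fun x hx => hasDerivAt_cexp_mul_log_sub c b (hpos x hx))
    (fun x hx => by
      have h : HasDerivAt (fun x : ℝ => (σ - x)⁻¹) (-(-1) / (σ - x) ^ 2) x :=
        ((hasDerivAt_id x).const_sub σ).inv (hin.trans_le (hd x hx)).ne'
      have h' := hasDerivAt_inv (hpos x hx).ne'
      refine ((h.const_mul ((‖c‖ + 1 + α) * w⁻¹)).sub
        (h'.const_mul ((‖c‖ + 1) * w⁻¹))).congr_deriv ?_
      ring)
    (fun x hx => abs_pos.1 ((hDp x hx).trans_le (hDp' x hx)))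
    (continuousOn_phase_deriv one_pos)
    (continuousOn_amplitude_deriv c b one_pos)
    (by
      refine (continuousOn_const.mul (ContinuousOn.inv₀ (by fun_prop) ?_)).add
        (continuousOn_const.mul (ContinuousOn.inv₀ (by fun_prop) ?_))
      · intro x hx
        exact pow_ne_zero 2 (hin.trans_le (hd x hx)).ne'
      · intro x hx
        exact pow_ne_zero 2 (hpos x hx).ne')
    (by
      intro x hx
      have hx0 := hpos x hx
      have h1 := norm_cexp_mul_log_sub_le c hb hx0
      have h2 := norm_deriv_cexp_mul_log_sub_le c hb hx0
      rw [hc] at h1 h2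
      have h3 := hDp' x hx
      have h3' := hD x hx
      have h4 := hDp x hx
      have h5 := hy x hx
      have h6 : 0 < σ - x := hin.trans_le (hd x hx)
      have h7 : |(α + 1) * (α * x ^ (α - 1))| = (α + 1) * α * (x ^ ((α - 1) / 2)) ^ 2 := by
        rw [rpow_sub_one_eq_sq hx0, abs_of_nonneg (by positivity)]; ring
      have h8 : (-((α + 1) * σ ^ α) + (α + 1) * x ^ α) ^ 2
          = |-((α + 1) * σ ^ α) + (α + 1) * x ^ α| ^ 2 := (sq_abs _).symm
      simp only [h7, h8]
      set y := x ^ ((α - 1) / 2) with hyd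
      have hy0 : 0 < y := by positivity
      have h9 : x⁻¹ * (σ - x)⁻¹ ≤ (x ^ 2)⁻¹ + ((σ - x) ^ 2)⁻¹ := by
        rw [← inv_pow, ← inv_pow]
        nlinarith [sq_nonneg (x⁻¹ - (σ - x)⁻¹), sq_nonneg x⁻¹, sq_nonneg (σ - x)⁻¹]
      calc _ ≤ ((‖c‖ + 1) * w / x) / (w ^ 2 * (σ - x))
            + w * ((α + 1) * α * w ^ 2) / ((w ^ 2 * (σ - x)) * (w ^ 2 * (σ - x) * (α + 1))) := by
            have h1' := h1.trans h5
            have h2' : ‖cexp (c * (Real.log x : ℂ) - b * x) * (c * (x⁻¹ : ℝ) - b)‖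
              ≤ (‖c‖ + 1) * w / x := h2.trans (by gcongr)
            gcongr
            rw [sq (|-((α + 1) * σ ^ α) + (α + 1) * x ^ α|)]
            gcongr
        _ = (‖c‖ + 1) * w⁻¹ * (x⁻¹ * (σ - x)⁻¹) + α * w⁻¹ * ((σ - x) ^ 2)⁻¹ := by
            field_simp
        _ ≤ (‖c‖ + 1) * w⁻¹ * ((x ^ 2)⁻¹ + ((σ - x) ^ 2)⁻¹) + α * w⁻¹ * ((σ - x) ^ 2)⁻¹ := by
            gcongr
        _ = _ := by ring)
  refine key.trans ?_
  have e1 := hbd (σ - w⁻¹) ⟨hσ, le_rfl⟩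
  have e2 := hbd 1 ⟨le_rfl, hσ⟩
  have e3 : 0 < (σ - 1)⁻¹ := inv_pos.2 (by linarith)
  have e4 : (‖c‖ + 1 + α) * w⁻¹ * (σ - (σ - w⁻¹))⁻¹ = ‖c‖ + 1 + α := by
    rw [sub_sub_cancel, inv_inv]; field_simp
  have e5 : 0 ≤ (‖c‖ + 1 + α) * w⁻¹ * (σ - 1)⁻¹ := by positivity
  have e6 : 0 ≤ (‖c‖ + 1) * w⁻¹ * (σ - w⁻¹)⁻¹ := by
    have : 0 < (σ - w⁻¹)⁻¹ := inv_pos.2 (by linarith)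
    positivity
  have e7 : (‖c‖ + 1) * w⁻¹ * (1 : ℝ)⁻¹ ≤ ‖c‖ + 1 := by
    rw [inv_one, mul_one]
    exact mul_le_of_le_one_right (by positivity) (inv_le_one_of_one_le₀ hw1)
  simp only [e4]
  linarith

lemma continuousOn_oscillatory_integrand (α s b : ℝ) (c : ℂ) :
    ContinuousOn (fun x : ℝ => cexp (I * (s * x + x ^ (α + 1) : ℝ)) *
      cexp (c * (Real.log x : ℂ) - b * x)) (Set.Ioi 0) := fun _ hx =>
  ((((hasDerivAt_phase s hx).ofReal_comp.const_mul I).cexp.mul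
    (hasDerivAt_cexp_mul_log_sub c b hx)).continuousAt).continuousWithinAt

lemma integrableOn_rpow_mul_exp_neg {a b : ℝ} (ha : -1 < a) (hb : 0 < b) :
    IntegrableOn (fun x : ℝ => x ^ a * rexp (-(b * x))) (Set.Ioi 0) := by
  simpa using integrableOn_rpow_mul_exp_neg_mul_rpow ha one_pos hb

lemma integrableOn_oscillatory_integrand (α s : ℝ) {b : ℝ} {c : ℂ} (hb : 0 < b) (hc : -1 < c.re) :
    IntegrableOn (fun x : ℝ => cexp (I * (s * x + x ^ (α + 1) : ℝ)) *
      cexp (c * (Real.log x : ℂ) - b * x)) (Set.Ioi 0) := by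
  refine (integrableOn_rpow_mul_exp_neg hc hb).mono'
    ((continuousOn_oscillatory_integrand α s b c).aestronglyMeasurable measurableSet_Ioi) ?_
  refine (ae_restrict_iff' measurableSet_Ioi).2 (ae_of_all _ fun x hx => ?_)
  rw [norm_mul, norm_exp_I_mul_ofReal, one_mul, norm_cexp_mul_log_sub c b hx]

lemma norm_oscillatory_trivial_le (α s : ℝ) {b u v M : ℝ} {c : ℂ} (hb : 0 ≤ b) (hc : 0 ≤ c.re)
    (hu : 0 ≤ u) (huv : u ≤ v) (hM : v ≤ M) :
    ‖∫ x in u..v, cexp (I * (s * x + x ^ (α + 1) : ℝ)) *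
      cexp (c * (Real.log x : ℂ) - b * x)‖ ≤ M ^ c.re * (v - u) := by
  refine (intervalIntegral.norm_integral_le_of_norm_le_const (C := M ^ c.re) ?_).trans
    (by rw [abs_of_nonneg (by linarith)])
  intro x hx
  rw [Set.uIoc_of_le huv] at hx
  have hx0 : 0 < x := hu.trans_lt hx.1
  rw [norm_mul, norm_exp_I_mul_ofReal, one_mul]
  exact (norm_cexp_mul_log_sub_le c hb hx0).trans
    (Real.rpow_le_rpow hx0.le (hx.2.trans hM) hc)

lemma norm_oscillatory_interval_le {α : ℝ} (hα : 1 < α) (s : ℝ) {b : ℝ} {c : ℂ} (hb : 0 < b)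
    (hc : c.re = (α - 1) / 2) :
    ∃ R₀ : ℝ, ∀ R ≥ R₀, ‖∫ x in (0 : ℝ)..R, cexp (I * (s * x + x ^ (α + 1) : ℝ)) *
      cexp (c * (Real.log x : ℂ) - b * x)‖ ≤
        (3 : ℝ) ^ ((α - 1) / 2) * 3 + 8 + 2 * α + 3 * ‖c‖ := by
  have hc0 : 0 ≤ c.re := by rw [hc]; linarith
  set f : ℝ → ℂ := fun x => cexp (I * (s * x + x ^ (α + 1) : ℝ)) *
      cexp (c * (Real.log x : ℂ) - b * x) with hf
  have hint : ∀ u v : ℝ, 0 ≤ u → u ≤ v → IntervalIntegrable f volume u v := by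
    intro u v hu huv
    rw [intervalIntegrable_iff_integrableOn_Ioc_of_le huv]
    exact (integrableOn_oscillatory_integrand α s hb (by linarith)).mono_set
      fun _ hx => hu.trans_lt hx.1
  have hσ : ∃ σ : ℝ, 1 ≤ σ ∧ -((α + 1) * σ ^ α) ≤ s ∧ (s = -((α + 1) * σ ^ α) ∨ σ = 1) := by
    by_cases h : s < -(α + 1)
    · have h1 : 1 ≤ -s / (α + 1) := by rw [le_div_iff₀ (by linarith)]; linarith
      have h2 : ((-s / (α + 1)) ^ α⁻¹) ^ α = -s / (α + 1) :=
        Real.rpow_inv_rpow (by linarith) (by linarith)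
      have h3 : s = -((α + 1) * ((-s / (α + 1)) ^ α⁻¹) ^ α) := by
        rw [h2]; field_simp
      exact ⟨(-s / (α + 1)) ^ α⁻¹, Real.one_le_rpow h1 (by positivity), h3.ge, Or.inl h3⟩
    · exact ⟨1, le_rfl, by simp only [Real.one_rpow]; linarith, Or.inr rfl⟩
  obtain ⟨σ, hσ1, hs, hor⟩ := hσ
  have hσ0 : 0 < σ := by linarith
  set h := (σ ^ ((α - 1) / 2))⁻¹ with hh
  have hw1 : 1 ≤ σ ^ ((α - 1) / 2) := Real.one_le_rpow hσ1 (by linarith)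
  have hh0 : 0 < h := by positivity
  have hh1 : h ≤ 1 := inv_le_one_of_one_le₀ hw1
  refine ⟨σ + h, fun R hR => ?_⟩
  have hright := norm_oscillatory_right_le hα hc hb.le hσ1 hs hR
  rw [← intervalIntegral.integral_add_adjacent_intervals
    (hint 0 (σ + h) le_rfl (by linarith)) (hint (σ + h) R (by linarith) hR)]
  refine (norm_add_le _ _).trans ?_
  have h3 : (0 : ℝ) ≤ 3 ^ ((α - 1) / 2) := by positivity
  have hc' : 0 ≤ ‖c‖ := norm_nonneg c
  suffices ‖∫ x in (0 : ℝ)..(σ + h), f x‖ ≤ (3 : ℝ) ^ ((α - 1) / 2) * 3 + 5 + α + 2 * ‖c‖ by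
    linarith
  by_cases hl : 1 ≤ σ - h
  · have hs' : s = -((α + 1) * σ ^ α) := by
      rcases hor with h' | h'
      · exact h'
      · linarith
    have hleft := norm_oscillatory_left_le hα hc hb.le hl hσ0
    rw [← hs'] at hleft
    have ht := norm_oscillatory_trivial_le α s hb.le hc0 le_rfl zero_le_one le_rfl
    have hm := norm_oscillatory_trivial_le α s (u := σ - h) (v := σ + h) (M := 2 * σ)
      hb.le hc0 (by linarith) (by linarith) (by linarith)
    rw [← intervalIntegral.integral_add_adjacent_intervals
      (hint 0 1 le_rfl zero_le_one) (hint 1 (σ + h) zero_le_one (by linarith)),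
      ← intervalIntegral.integral_add_adjacent_intervals
      (hint 1 (σ - h) zero_le_one hl) (hint (σ - h) (σ + h) (by linarith) (by linarith))]
    have hm' : (2 * σ) ^ c.re * (σ + h - (σ - h)) ≤ 3 ^ ((α - 1) / 2) * 3 := by
      rw [hc, Real.mul_rpow (by norm_num) hσ0.le]
      have e : σ ^ ((α - 1) / 2) * h = 1 := mul_inv_cancel₀ (by positivity)
      have e2 : (2 : ℝ) ^ ((α - 1) / 2) ≤ 3 ^ ((α - 1) / 2) :=
        Real.rpow_le_rpow (by norm_num) (by norm_num) (by linarith)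
      calc _ = 2 * 2 ^ ((α - 1) / 2) * (σ ^ ((α - 1) / 2) * h) := by ring
        _ ≤ _ := by rw [e]; linarith
    rw [Real.one_rpow] at ht
    refine (norm_add_le _ _).trans ((add_le_add_right (norm_add_le _ _) _).trans ?_)
    linarith
  · have ht := norm_oscillatory_trivial_le α s (u := 0) (v := σ + h) (M := 3)
      hb.le hc0 le_rfl (by linarith) (by linarith)
    rw [hc] at ht
    have : (3 : ℝ) ^ ((α - 1) / 2) * (σ + h - 0) ≤ 3 ^ ((α - 1) / 2) * 3 := by
      gcongr; linarith
    linarith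

lemma norm_oscillatory_Ioi_le {α : ℝ} (hα : 1 < α) (s : ℝ) {b : ℝ} {c : ℂ} (hb : 0 < b)
    (hc : c.re = (α - 1) / 2) :
    ‖∫ x in Set.Ioi (0 : ℝ), cexp (I * (s * x + x ^ (α + 1) : ℝ)) *
      cexp (c * (Real.log x : ℂ) - b * x)‖ ≤
        (3 : ℝ) ^ ((α - 1) / 2) * 3 + 8 + 2 * α + 3 * ‖c‖ := by
  obtain ⟨R₀, hR₀⟩ := norm_oscillatory_interval_le hα s hb hc
  refine le_of_tendsto (intervalIntegral_tendsto_integral_Ioi 0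
    (integrableOn_oscillatory_integrand α s hb (by rw [hc]; linarith)) Filter.tendsto_id).norm ?_
  filter_upwards [Filter.eventually_ge_atTop R₀] with R hR using hR₀ R hR

lemma norm_oscillatory_Ioi_le_of_pos {α : ℝ} (hα : 1 < α) (s : ℝ) {t b : ℝ} {c : ℂ} (ht : 0 < t)
    (hb : 0 < b) (hc : c.re = (α - 1) / 2) :
    ‖∫ x in Set.Ioi (0 : ℝ), cexp (I * (s * x + t * x ^ (α + 1) : ℝ)) *
      cexp (c * (Real.log x : ℂ) - b * x)‖ ≤
        ((3 : ℝ) ^ ((α - 1) / 2) * 3 + 8 + 2 * α + 3 * ‖c‖) * t ^ (-(1 / 2) : ℝ) := by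
  set l := t ^ (-(α + 1)⁻¹) with hl
  have hl0 : 0 < l := by positivity
  have hlt : t * l ^ (α + 1) = 1 := by
    rw [hl, ← Real.rpow_mul ht.le, neg_mul, inv_mul_cancel₀ (by linarith), Real.rpow_neg_one,
      mul_inv_cancel₀ ht.ne']
  have hls : l * l ^ ((α - 1) / 2) = t ^ (-(1 / 2) : ℝ) := by
    rw [← Real.rpow_one_add' hl0.le (by linarith), hl, ← Real.rpow_mul ht.le]
    congr 1
    field_simp
    ring
  have key := integral_comp_mul_left_Ioi (fun x : ℝ => cexp (I * (s * x + t * x ^ (α + 1) : ℝ)) *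
      cexp (c * (Real.log x : ℂ) - b * x)) 0 hl0
  rw [mul_zero, eq_inv_smul_iff₀ hl0.ne'] at key
  rw [← key]
  have e : ∫ x in Set.Ioi (0 : ℝ), cexp (I * (s * (l * x) + t * (l * x) ^ (α + 1) : ℝ)) *
      cexp (c * (Real.log (l * x) : ℂ) - b * (l * x : ℝ)) =
      cexp (c * (Real.log l : ℂ)) * ∫ x in Set.Ioi (0 : ℝ),
        cexp (I * ((s * l) * x + x ^ (α + 1) : ℝ)) *
          cexp (c * (Real.log x : ℂ) - (b * l : ℝ) * x) := by
    rw [← integral_const_mul]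
    refine setIntegral_congr_fun measurableSet_Ioi fun x hx => ?_
    have hx0 : 0 < x := hx
    have e1 : s * (l * x) + t * (l * x) ^ (α + 1) = s * l * x + x ^ (α + 1) := by
      rw [Real.mul_rpow hl0.le hx0.le, ← mul_assoc t, hlt]; ring
    simp only [e1, Real.log_mul hl0.ne' hx0.ne']
    rw [← Complex.exp_add, ← Complex.exp_add, ← Complex.exp_add]
    congr 1
    push_cast
    ring
  rw [e, norm_smul, norm_mul, Real.norm_of_nonneg hl0.le]
  have e3 : ‖cexp (c * (Real.log l : ℂ))‖ = l ^ ((α - 1) / 2) := by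
    have := norm_cexp_mul_log_sub c 0 hl0
    simpa [hc] using this
  rw [e3, ← mul_assoc, hls, mul_comm]
  gcongr
  exact norm_oscillatory_Ioi_le hα (s * l) (mul_pos hb hl0) hc

/-- Decay of the half-line oscillatory integral with critical amplitude. -/
lemma norm_oscillatory_Ioi_le_abs {α : ℝ} (hα : 1 < α) (s : ℝ) {t b : ℝ} {c : ℂ} (ht : t ≠ 0)
    (hb : 0 < b) (hc : c.re = (α - 1) / 2) :
    ‖∫ x in Set.Ioi (0 : ℝ), cexp (I * (s * x + t * x ^ (α + 1) : ℝ)) *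
      cexp (c * (Real.log x : ℂ) - b * x)‖ ≤
        ((3 : ℝ) ^ ((α - 1) / 2) * 3 + 8 + 2 * α + 3 * ‖c‖) * |t| ^ (-(1 / 2) : ℝ) := by
  rcases lt_or_gt_of_ne ht with h | h
  · have := norm_oscillatory_Ioi_le_of_pos hα (-s) (t := -t) (c := (starRingEnd ℂ) c)
      (by linarith) hb (by simpa using hc)
    rw [abs_of_neg h]
    rw [RCLike.norm_conj] at this
    refine le_trans (le_of_eq ?_) this
    rw [← RCLike.norm_conj, ← integral_conj]
    congr 2
    ext x
    rw [map_mul, ← Complex.exp_conj, ← Complex.exp_conj]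
    congr 2
    · simp only [map_mul, conj_I, conj_ofReal]
      push_cast
      ring
    · simp
  · rw [abs_of_pos h]
    exact norm_oscillatory_Ioi_le_of_pos hα s h hb hc

lemma integral_gaussian_half {ε : ℝ} (hε : 0 < ε) (t : ℝ) {x : ℝ} (hx : 0 < x) (y : ℝ) :
    ∫ v : ℝ, cexp (I * (y * v : ℝ)) * cexp (-((ε + t * I) / x) * (v : ℂ) ^ 2) =
      (π / (ε + t * I)) ^ (1 / 2 : ℂ) * (cexp ((1 / 2 : ℂ) * (Real.log x : ℂ)) *
        cexp (I * (t * y ^ 2 / (4 * (ε ^ 2 + t ^ 2)) * x : ℝ) -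
          (ε * y ^ 2 / (4 * (ε ^ 2 + t ^ 2)) : ℝ) * x)) := by
  have hb : 0 < ((ε + t * I) / x).re := by
    rw [Complex.div_ofReal_re]
    have : (ε + t * I).re = ε := by simp
    rw [this]; positivity
  have hx' : (x : ℂ) ≠ 0 := by exact_mod_cast hx.ne'
  have hε' : (ε + t * I) ≠ 0 := by
    intro h
    have := congrArg Complex.re h
    simp at this
    exact hε.ne' this
  have hN : 0 < ε ^ 2 + t ^ 2 := by positivity
  have hN' : ((ε : ℂ) ^ 2 + t ^ 2) ≠ 0 := by exact_mod_cast hN.ne'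
  have hm : (ε + t * I) * (ε - t * I) = (ε : ℂ) ^ 2 + t ^ 2 := by
    ring_nf; rw [I_sq]; ring
  have h := fourierIntegral_gaussian hb (y : ℂ)
  have e0 : ∀ v : ℝ, cexp (I * (y * v : ℝ)) = cexp (I * y * v) := fun v => by
    congr 1; push_cast; ring
  simp_rw [e0]
  rw [h]
  have e1 : (π : ℂ) / ((ε + t * I) / x) = (x : ℝ) * (π / (ε + t * I)) := by
    field_simp
  have e2 : ((x : ℝ) * (π / (ε + t * I)) : ℂ) ^ (1 / 2 : ℂ)
      = cexp ((1 / 2 : ℂ) * (Real.log x : ℂ)) * (π / (ε + t * I)) ^ (1 / 2 : ℂ) := by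
    have hne : (π : ℂ) / (ε + t * I) ≠ 0 := div_ne_zero (by exact_mod_cast Real.pi_ne_zero) hε'
    rw [Complex.cpow_def_of_ne_zero (mul_ne_zero hx' hne), Complex.log_ofReal_mul hx hne,
      Complex.cpow_def_of_ne_zero hne, ← Complex.exp_add]
    congr 1; ring
  have e3 : -(y : ℂ) ^ 2 / (4 * ((ε + t * I) / x)) =
      I * (t * y ^ 2 / (4 * (ε ^ 2 + t ^ 2)) * x : ℝ) -
          (ε * y ^ 2 / (4 * (ε ^ 2 + t ^ 2)) : ℝ) * x := by
    have : ((ε + t * I))⁻¹ = (ε - t * I) / ((ε : ℂ) ^ 2 + t ^ 2) := by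
      rw [← hm]; 
      have : (ε - t * I) ≠ 0 := by
        intro h
        have := congrArg Complex.re h
        simp at this
        exact hε.ne' this
      field_simp
    calc -(y : ℂ) ^ 2 / (4 * ((ε + t * I) / x)) = -(y : ℂ) ^ 2 * x / 4 * (ε + t * I)⁻¹ := by
          field_simp
      _ = _ := by
          rw [this]; push_cast; field_simp; ring
  rw [e1, e2, e3]
  ring

/-- The regularised multiplier, continued analytically in the order `z` of differentiation. -/
noncomputable def kpSymbol (α t ε : ℝ) (z : ℂ) (q : ℝ × ℝ) : ℂ :=
  cexp (I * (t * (q.1 * |q.1| ^ α - q.2 ^ 2 / q.1) : ℝ)) *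
    (rexp (-(ε * |q.1| + ε * q.2 ^ 2 / |q.1|)) : ℝ) *
    cexp (z * (-(1 - α / 2) * Real.log |q.1| : ℝ))

lemma measurable_kpSymbol (α t ε : ℝ) (z : ℂ) : Measurable (kpSymbol α t ε z) := by
  unfold kpSymbol
  fun_prop

lemma norm_kpSymbol (α t ε : ℝ) (z : ℂ) (q : ℝ × ℝ) :
    ‖kpSymbol α t ε z q‖ = rexp (-(ε * |q.1| + ε * q.2 ^ 2 / |q.1|)) *
      rexp (z.re * (-(1 - α / 2) * Real.log |q.1|)) := by
  unfold kpSymbol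
  rw [norm_mul, norm_mul, norm_exp_I_mul_ofReal, one_mul, Complex.norm_real,
    Real.norm_of_nonneg (Real.exp_pos _).le, Complex.norm_exp, Complex.re_mul_ofReal]

lemma norm_kpSymbol_mk (α t ε : ℝ) (z : ℂ) (x v : ℝ) :
    ‖kpSymbol α t ε z (x, v)‖ =
      (rexp (-(ε * |x|)) * rexp (z.re * (-(1 - α / 2) * Real.log |x|))) *
        rexp (-(ε / |x|) * v ^ 2) := by
  have e : rexp (-(ε * |x| + ε * v ^ 2 / |x|)) =
      rexp (-(ε * |x|)) * rexp (-(ε / |x|) * v ^ 2) := by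
    rw [← Real.exp_add]; congr 1; ring
  rw [norm_kpSymbol, e]
  ring

lemma integrable_of_even_of_integrableOn_Ioi {f : ℝ → ℝ} (hf : ∀ x, f (-x) = f x)
    (h : IntegrableOn f (Set.Ioi 0)) : Integrable f := by
  have h1 : IntegrableOn f (Set.Iic 0) := by
    rw [integrableOn_Iic_iff_integrableOn_Iio]
    have h2 := ((Measure.measurePreserving_neg (volume : Measure ℝ)).integrableOn_comp_preimage
      (Homeomorph.neg ℝ).measurableEmbedding (f := f) (s := Set.Ioi 0)).2 h
    refine (h2.congr_fun (fun x _ => hf x) (measurableSet_Ioi.preimage measurable_neg)).mono_set ?_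
    intro x hx
    simpa using hx
  rw [← integrableOn_univ, ← Set.Iic_union_Ioi (a := (0 : ℝ))]
  exact h1.union h

lemma integrable_kpSymbol {α : ℝ} (t : ℝ) {ε : ℝ} (hε : 0 < ε) {z : ℂ}
    (hz : -1 < 1 / 2 - z.re * (1 - α / 2)) : Integrable (kpSymbol α t ε z) := by
  have hm := (measurable_kpSymbol α t ε z).aestronglyMeasurable (μ := (volume : Measure (ℝ × ℝ)))
  have h0 : ∀ᵐ x : ℝ, x ≠ 0 := by simp [ae_iff]
  refine (integrable_prod_iff hm).2 ⟨?_, ?_⟩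
  · filter_upwards [h0] with x hx
    have hx' : 0 < |x| := abs_pos.2 hx
    have hg := (integrable_exp_neg_mul_sq (div_pos hε hx')).const_mul
      (rexp (-(ε * |x|)) * rexp (z.re * (-(1 - α / 2) * Real.log |x|)))
    refine hg.mono' ((measurable_kpSymbol α t ε z).comp
      measurable_prodMk_left).aestronglyMeasurable (ae_of_all _ fun v => le_of_eq ?_)
    exact norm_kpSymbol_mk α t ε z x v
  · have hev : Integrable (fun x : ℝ => |x| ^ (1 / 2 - z.re * (1 - α / 2)) * rexp (-(ε * |x|))) := by
      refine integrable_of_even_of_integrableOn_Ioi (by simp) ?_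
      refine (integrableOn_rpow_mul_exp_neg hz hε).congr_fun (fun x hx => ?_) measurableSet_Ioi
      simp only [abs_of_pos (show 0 < x from hx)]
    refine (hev.const_mul (√(π / ε))).congr ?_
    filter_upwards [h0] with x hx
    have hx' : 0 < |x| := abs_pos.2 hx
    simp_rw [norm_kpSymbol_mk]
    rw [integral_const_mul, integral_gaussian]
    have e1 : π / (ε / |x|) = (π / ε) * |x| := by field_simp
    rw [e1, Real.sqrt_mul (by positivity), Real.sqrt_eq_rpow |x|,
      Real.rpow_def_of_pos hx', Real.rpow_def_of_pos hx']
    have e2 : rexp (Real.log |x| * (1 / 2 - z.re * (1 - α / 2))) =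
      rexp (z.re * (-(1 - α / 2) * Real.log |x|)) * rexp (Real.log |x| * (1 / 2)) := by
      rw [← Real.exp_add]; congr 1; ring
    rw [e2]; ring

lemma norm_half_kernel_le {α : ℝ} (hα1 : 1 < α) {t ε : ℝ} (ht : t ≠ 0) (hε : 0 < ε)
    {z : ℂ} (hz : z.re = 1) (y₁ y₂ : ℝ) :
    ‖∫ x in Set.Ioi (0 : ℝ), ∫ v : ℝ, cexp (I * (y₁ * x + y₂ * v : ℝ)) * kpSymbol α t ε z (x, v)‖ ≤
      √π * ((3 : ℝ) ^ ((α - 1) / 2) * 3 + 8 + 2 * α +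
        3 * ‖-z * (1 - α / 2 : ℝ) + 1 / 2‖) * |t|⁻¹ := by
  set N := ε ^ 2 + t ^ 2 with hN
  have hN0 : 0 < N := by positivity
  set b := ε + ε * y₂ ^ 2 / (4 * N) with hb
  have hb0 : 0 < b := by positivity
  set c : ℂ := -z * (1 - α / 2 : ℝ) + 1 / 2 with hc
  have hcre : c.re = (α - 1) / 2 := by
    rw [hc, Complex.add_re, Complex.re_mul_ofReal]
    simp [hz]
    ring
  have hin : ∀ x ∈ Set.Ioi (0 : ℝ),
      ∫ v : ℝ, cexp (I * (y₁ * x + y₂ * v : ℝ)) * kpSymbol α t ε z (x, v) =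
      (π / (ε + t * I)) ^ (1 / 2 : ℂ) *
        (cexp (I * ((y₁ + t * y₂ ^ 2 / (4 * N)) * x + t * x ^ (α + 1) : ℝ)) *
          cexp (c * (Real.log x : ℂ) - b * x)) := by
    intro x hx
    have hx0 : 0 < x := hx
    have e1 : ∀ v : ℝ, cexp (I * (y₁ * x + y₂ * v : ℝ)) * kpSymbol α t ε z (x, v) =
        cexp (I * (y₁ * x + t * x ^ (α + 1) : ℝ) - ε * x - z * (1 - α / 2 : ℝ) * Real.log x) *
        (cexp (I * (y₂ * v : ℝ)) * cexp (-((ε + t * I) / x) * (v : ℂ) ^ 2)) := by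
      intro v
      unfold kpSymbol
      simp only [abs_of_pos hx0]
      have : x ^ (α + 1) = x * x ^ α := by rw [Real.rpow_add_one hx0.ne']; ring
      rw [this]
      push_cast
      simp only [← Complex.exp_add]
      congr 1
      ring
    simp_rw [e1]
    rw [integral_const_mul, integral_gaussian_half hε t hx0, mul_left_comm]
    congr 1
    rw [← Complex.exp_add, ← Complex.exp_add, ← Complex.exp_add]
    congr 1
    rw [hb, hc, hN]
    push_cast
    ring
  rw [setIntegral_congr_fun measurableSet_Ioi hin, integral_const_mul, norm_mul]
  have h1 := norm_oscillatory_Ioi_le_abs hα1 (y₁ + t * y₂ ^ 2 / (4 * N)) ht hb0 hcre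
  have ht0 : 0 < |t| := abs_pos.2 ht
  have h2 : ‖((π : ℂ) / (ε + t * I)) ^ (1 / 2 : ℂ)‖ ≤ √π * |t| ^ (-(1 / 2) : ℝ) := by
    have e : (1 / 2 : ℂ) = ((1 / 2 : ℝ) : ℂ) := by push_cast; rfl
    rw [e, Complex.norm_cpow_real, norm_div, Complex.norm_real, Real.norm_of_nonneg Real.pi_pos.le,
      Real.sqrt_eq_rpow, Real.rpow_neg ht0.le, ← div_eq_mul_inv, ← Real.div_rpow Real.pi_pos.le ht0.le]
    gcongr
    have := Complex.abs_im_le_norm ((ε : ℂ) + t * I)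
    simpa using this
  have h3 : |t| ^ (-(1 / 2) : ℝ) * |t| ^ (-(1 / 2) : ℝ) = |t|⁻¹ := by
    rw [← Real.rpow_add ht0, ← Real.rpow_neg_one]; norm_num
  calc _ ≤ (√π * |t| ^ (-(1 / 2) : ℝ)) * (((3 : ℝ) ^ ((α - 1) / 2) * 3 + 8 + 2 * α +
        3 * ‖c‖) * |t| ^ (-(1 / 2) : ℝ)) := by gcongr
    _ = √π * ((3 : ℝ) ^ ((α - 1) / 2) * 3 + 8 + 2 * α +
        3 * ‖c‖) * (|t| ^ (-(1 / 2) : ℝ) * |t| ^ (-(1 / 2) : ℝ)) := by ring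
    _ = _ := by rw [h3]

/-- Uniform dispersive bound for the kernel on the line `re z = 1`. -/
lemma exists_norm_kernel_le {α : ℝ} (hα1 : 1 < α) :
    ∃ C > 0, ∀ (t ε : ℝ), t ≠ 0 → 0 < ε → ∀ z : ℂ, z.re = 1 → ∀ y : ℝ × ℝ,
      ‖∫ q : ℝ × ℝ, cexp (I * (y.1 * q.1 + y.2 * q.2 : ℝ)) * kpSymbol α t ε z q‖ ≤
        C * |t|⁻¹ * (1 + |z.im|) := by
  set θ := |1 - α / 2| with hθ
  set K := (3 : ℝ) ^ ((α - 1) / 2) * 3 + 8 + 2 * α with hK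
  have hK0 : 0 < K := by positivity
  refine ⟨2 * (√π * (K + 3 * (θ + 1))), by positivity, fun t ε ht hε z hz y => ?_⟩
  have hint : Integrable (fun q : ℝ × ℝ =>
      cexp (I * (y.1 * q.1 + y.2 * q.2 : ℝ)) * kpSymbol α t ε z q) := by
    refine (integrable_kpSymbol (α := α) t hε (z := z) (by rw [hz]; linarith)).bdd_mul (c := 1)
      (by fun_prop) (ae_of_all _ fun q => ?_)
    rw [norm_exp_I_mul_ofReal]
  have hc : ‖-z * (1 - α / 2 : ℝ) + 1 / 2‖ ≤ (θ + 1) * (1 + |z.im|) := by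
    have h1 : ‖z‖ ≤ 1 + |z.im| := by
      simpa [hz] using Complex.norm_le_abs_re_add_abs_im z
    refine (norm_add_le _ _).trans ?_
    rw [norm_mul, norm_neg, Complex.norm_real, Real.norm_eq_abs, ← hθ]
    have h2 : ‖(1 / 2 : ℂ)‖ ≤ 1 := by norm_num
    have h3 : 0 ≤ θ := abs_nonneg _
    nlinarith [abs_nonneg z.im]
  rw [Measure.volume_eq_prod, integral_prod _ (by rwa [← Measure.volume_eq_prod])]
  have hI : Integrable (fun x : ℝ => ∫ v : ℝ,
      cexp (I * (y.1 * x + y.2 * v : ℝ)) * kpSymbol α t ε z (x, v)) := by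
    rw [Measure.volume_eq_prod] at hint
    exact hint.integral_prod_left
  rw [← intervalIntegral.integral_Iic_add_Ioi hI.integrableOn hI.integrableOn (b := 0)]
  have hneg := integral_comp_neg_Ioi 0 (fun x : ℝ => ∫ v : ℝ,
      cexp (I * (y.1 * x + y.2 * v : ℝ)) * kpSymbol α t ε z (x, v))
  rw [neg_zero] at hneg
  have hsym : ∀ x v : ℝ, kpSymbol α t ε z (-x, v) = kpSymbol α (-t) ε z (x, v) := by
    intro x v
    unfold kpSymbol
    simp only [abs_neg]
    congr 5
    rw [div_neg]
    ring
  rw [← hneg]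
  have e : ∀ x v : ℝ, y.1 * -x + y.2 * v = -y.1 * x + y.2 * v := fun x v => by ring
  simp_rw [hsym, e]
  have b1 := norm_half_kernel_le hα1 ht hε hz y.1 y.2
  have b2 := norm_half_kernel_le hα1 (neg_ne_zero.2 ht) hε hz (-y.1) y.2
  rw [abs_neg] at b2
  refine (norm_add_le _ _).trans ((add_le_add b2 b1).trans ?_)
  rw [← two_mul, mul_assoc 2, mul_assoc 2]
  refine mul_le_mul_of_nonneg_left ?_ (by norm_num)
  calc √π * (K + 3 * ‖-z * (1 - α / 2 : ℝ) + 1 / 2‖) * |t|⁻¹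
      ≤ √π * (K * (1 + |z.im|) + 3 * ((θ + 1) * (1 + |z.im|))) * |t|⁻¹ := by
        gcongr
        nlinarith [abs_nonneg z.im]
    _ = _ := by ring

/-- Fatou's lemma for Bochner integrals of nonnegative functions. -/
lemma integrable_and_integral_le_of_tendsto {X : Type*} [MeasurableSpace X] {μ : Measure X}
    {g : X → ℝ} {h : ℕ → X → ℝ} {M : ℝ} (hg : Measurable g)
    (hh : ∀ n, Integrable (h n) μ) (hm : ∀ n, Measurable (h n)) (h0 : ∀ n x, 0 ≤ h n x)
    (hM : ∀ n, ∫ x, h n x ∂μ ≤ M)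
    (hl : ∀ x, Filter.Tendsto (fun n => h n x) Filter.atTop (nhds (g x))) :
    Integrable g μ ∧ ∫ x, g x ∂μ ≤ M := by
  have hg0 : ∀ x, 0 ≤ g x := fun x => ge_of_tendsto' (hl x) fun n => h0 n x
  have hM0 : 0 ≤ M := (integral_nonneg (h0 0)).trans (hM 0)
  have key : ∫⁻ x, ENNReal.ofReal (g x) ∂μ ≤ ENNReal.ofReal M := by
    have e : ∀ x, ENNReal.ofReal (g x) =
        Filter.liminf (fun n => ENNReal.ofReal (h n x)) Filter.atTop := fun x =>
      ((ENNReal.continuous_ofReal.tendsto _).comp (hl x)).liminf_eq.symm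
    simp_rw [e]
    refine (lintegral_liminf_le fun n => (hm n).ennreal_ofReal).trans ?_
    refine Filter.liminf_le_of_le (by isBoundedDefault) fun b hb => ?_
    obtain ⟨n, hn⟩ := hb.exists
    refine hn.trans ?_
    rw [← ofReal_integral_eq_lintegral_ofReal (hh n) (ae_of_all _ (h0 n))]
    exact ENNReal.ofReal_le_ofReal (hM n)
  refine ⟨⟨hg.aestronglyMeasurable, ?_⟩, ?_⟩
  · rw [hasFiniteIntegral_iff_ofReal (ae_of_all _ hg0)]
    exact key.trans_lt ENNReal.ofReal_lt_top
  · rw [integral_eq_lintegral_of_nonneg_ae (ae_of_all _ hg0) hg.aestronglyMeasurable]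
    exact ENNReal.toReal_le_of_le_ofReal hM0 key

lemma integral_gaussian_plane {δ : ℝ} (hδ : 0 < δ) (y : ℝ × ℝ) :
    ∫ q : ℝ × ℝ, cexp (I * (y.1 * q.1 + y.2 * q.2 : ℝ)) * (rexp (-δ * (q.1 ^ 2 + q.2 ^ 2)) : ℝ) =
      (π / δ * rexp (-(1 / (4 * δ)) * (y.1 ^ 2 + y.2 ^ 2)) : ℝ) := by
  have e : ∀ q : ℝ × ℝ,
      cexp (I * (y.1 * q.1 + y.2 * q.2 : ℝ)) * (rexp (-δ * (q.1 ^ 2 + q.2 ^ 2)) : ℝ) =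
      (cexp (I * y.1 * q.1) * cexp (-δ * (q.1 : ℂ) ^ 2)) *
        (cexp (I * y.2 * q.2) * cexp (-δ * (q.2 : ℂ) ^ 2)) := by
    intro q
    push_cast
    simp only [← Complex.exp_add]
    congr 1
    ring
  have hδ' : 0 < (δ : ℂ).re := by simpa using hδ
  simp_rw [e]
  rw [Measure.volume_eq_prod, integral_prod_mul (fun x : ℝ => cexp (I * y.1 * x) * cexp (-δ * (x : ℂ) ^ 2))
    (fun x : ℝ => cexp (I * y.2 * x) * cexp (-δ * (x : ℂ) ^ 2)), fourierIntegral_gaussian hδ',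
    fourierIntegral_gaussian hδ']
  have h : ((π : ℂ) / δ) ^ (1 / 2 : ℂ) * ((π : ℂ) / δ) ^ (1 / 2 : ℂ) = π / δ := by
    rw [← Complex.cpow_add _ _ (div_ne_zero (by exact_mod_cast Real.pi_ne_zero)
      (by exact_mod_cast hδ.ne'))]
    norm_num
  rw [mul_mul_mul_comm, h, ← Complex.exp_add]
  push_cast
  congr 2
  field_simp
  ring

lemma integrable_gaussian_plane {δ : ℝ} (hδ : 0 < δ) :
    Integrable fun q : ℝ × ℝ => rexp (-δ * (q.1 ^ 2 + q.2 ^ 2)) := by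
  have := (integrable_exp_neg_mul_sq hδ).mul_prod (integrable_exp_neg_mul_sq hδ)
  rw [← Measure.volume_eq_prod] at this
  refine this.congr (ae_of_all _ fun q => ?_)
  simp only
  rw [← Real.exp_add]; congr 1; ring

lemma integral_dual_gaussian_plane {δ : ℝ} (hδ : 0 < δ) :
    ∫ y : ℝ × ℝ, π / δ * rexp (-(1 / (4 * δ)) * (y.1 ^ 2 + y.2 ^ 2)) = (2 * π) ^ 2 := by
  have h := integral_gaussian_plane (δ := 1 / (4 * δ)) (by positivity) 0
  simp only [Prod.fst_zero, Prod.snd_zero, zero_mul, add_zero, Complex.ofReal_zero, mul_zero,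
    Complex.exp_zero, one_mul] at h
  rw [integral_complex_ofReal] at h
  have h := Complex.ofReal_injective h
  rw [integral_const_mul, h]
  simp
  field_simp
  ring

/-- The (inverse) Fourier integral on the plane, without normalisation. -/
noncomputable def planeFourier (f : ℝ × ℝ → ℂ) (q : ℝ × ℝ) : ℂ :=
  ∫ p : ℝ × ℝ, cexp (I * (p.1 * q.1 + p.2 * q.2 : ℝ)) * f p

lemma measurable_planeFourier {f : ℝ × ℝ → ℂ} (hf : Measurable f) :
    Measurable (planeFourier f) := by
  have h : Measurable fun z : (ℝ × ℝ) × (ℝ × ℝ) =>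
      cexp (I * (z.2.1 * z.1.1 + z.2.2 * z.1.2 : ℝ)) * f z.2 := by fun_prop
  exact h.stronglyMeasurable.integral_prod_right'.measurable

lemma norm_planeFourier_le (f : ℝ × ℝ → ℂ) (q : ℝ × ℝ) : ‖planeFourier f q‖ ≤ ∫ p, ‖f p‖ := by
  refine (norm_integral_le_integral_norm _).trans_eq ?_
  congr 1 with p
  rw [norm_mul, norm_exp_I_mul_ofReal, one_mul]

lemma integral_mul_gaussian_sub {g : ℝ × ℝ → ℝ} (hg : Integrable g) {δ : ℝ} (hδ : 0 < δ) :
    Integrable (fun P : (ℝ × ℝ) × (ℝ × ℝ) => g P.2 *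
      (π / δ * rexp (-(1 / (4 * δ)) * ((P.1 - P.2).1 ^ 2 + (P.1 - P.2).2 ^ 2)))) ∧
    ∫ P : (ℝ × ℝ) × (ℝ × ℝ), g P.2 *
      (π / δ * rexp (-(1 / (4 * δ)) * ((P.1 - P.2).1 ^ 2 + (P.1 - P.2).2 ^ 2))) =
      (2 * π) ^ 2 * ∫ p, g p := by
  have hG : Integrable fun y : ℝ × ℝ => π / δ * rexp (-(1 / (4 * δ)) * (y.1 ^ 2 + y.2 ^ 2)) :=
    (integrable_gaussian_plane (by positivity)).const_mul _
  have hi := hg.convolution_integrand (ContinuousLinearMap.mul ℝ ℝ) hG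
  simp only [ContinuousLinearMap.mul_apply'] at hi
  refine ⟨hi, ?_⟩
  rw [Measure.volume_eq_prod, integral_prod_symm _ hi]
  simp only
  have : ∀ y : ℝ × ℝ, ∫ x : ℝ × ℝ, g y *
      (π / δ * rexp (-(1 / (4 * δ)) * ((x - y).1 ^ 2 + (x - y).2 ^ 2))) = g y * (2 * π) ^ 2 := by
    intro y
    rw [integral_const_mul, integral_sub_right_eq_self (fun x : ℝ × ℝ =>
      π / δ * rexp (-(1 / (4 * δ)) * (x.1 ^ 2 + x.2 ^ 2))), integral_dual_gaussian_plane hδ]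
  simp_rw [this]
  rw [integral_mul_const, mul_comm]

lemma integral_norm_planeFourier_sq_mul_gaussian_le {f : ℝ × ℝ → ℂ} (hf : Integrable f)
    (hf2 : Integrable fun p => ‖f p‖ ^ 2) {δ : ℝ} (hδ : 0 < δ) :
    ∫ q, ‖planeFourier f q‖ ^ 2 * rexp (-δ * (q.1 ^ 2 + q.2 ^ 2)) ≤
      (2 * π) ^ 2 * ∫ p, ‖f p‖ ^ 2 := by
  set K : ((ℝ × ℝ) × (ℝ × ℝ)) → (ℝ × ℝ) → ℂ := fun P q =>
    (f P.1 * (starRingEnd ℂ) (f P.2)) * (cexp (I * ((P.1 - P.2).1 * q.1 + (P.1 - P.2).2 * q.2 : ℝ)) *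
      (rexp (-δ * (q.1 ^ 2 + q.2 ^ 2)) : ℝ)) with hK
  have hff : Integrable fun P : (ℝ × ℝ) × (ℝ × ℝ) => f P.1 * (starRingEnd ℂ) (f P.2) :=
    hf.mul_prod (Complex.conjLIE.integrable_comp_iff.2 hf)
  have hKi : Integrable (Function.uncurry K) (volume.prod volume) := by
    have h1 : Integrable (fun z : ((ℝ × ℝ) × (ℝ × ℝ)) × (ℝ × ℝ) =>
        (f z.1.1 * (starRingEnd ℂ) (f z.1.2)) * ((rexp (-δ * (z.2.1 ^ 2 + z.2.2 ^ 2)) : ℝ) : ℂ))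
        (volume.prod volume) := hff.mul_prod (μ := volume) (ν := volume) 
      ((integrable_gaussian_plane hδ).ofReal (𝕜 := ℂ))
    refine (h1.bdd_mul (c := 1) (f := fun z : ((ℝ × ℝ) × (ℝ × ℝ)) × (ℝ × ℝ) =>
      cexp (I * ((z.1.1 - z.1.2).1 * z.2.1 + (z.1.1 - z.1.2).2 * z.2.2 : ℝ))) (by fun_prop)
      (ae_of_all _ fun q => ?_)).congr (ae_of_all _ fun q => ?_)
    · rw [norm_exp_I_mul_ofReal]
    · simp only [hK, Function.uncurry]
      ring
  have e1 : ∀ q : ℝ × ℝ, ((‖planeFourier f q‖ ^ 2 * rexp (-δ * (q.1 ^ 2 + q.2 ^ 2)) : ℝ) : ℂ) =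
      ∫ P, K P q := by
    intro q
    have h : (‖planeFourier f q‖ ^ 2 : ℂ) =
        ∫ P : (ℝ × ℝ) × (ℝ × ℝ), (cexp (I * (P.1.1 * q.1 + P.1.2 * q.2 : ℝ)) * f P.1) *
          (starRingEnd ℂ) (cexp (I * (P.2.1 * q.1 + P.2.2 * q.2 : ℝ)) * f P.2) := by
      rw [Measure.volume_eq_prod, integral_prod_mul (fun p : ℝ × ℝ =>
        (cexp (I * (p.1 * q.1 + p.2 * q.2 : ℝ)) * f p)) (fun p : ℝ × ℝ => (starRingEnd ℂ)
        (cexp (I * (p.1 * q.1 + p.2 * q.2 : ℝ)) * f p)), integral_conj,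
        Complex.mul_conj, Complex.normSq_eq_norm_sq, planeFourier]
      push_cast; rfl
    rw [Complex.ofReal_mul, Complex.ofReal_pow, h, ← integral_mul_const]
    congr 1 with P
    rw [hK]
    simp only [map_mul, ← Complex.exp_conj, Complex.conj_I, Complex.conj_ofReal]
    rw [mul_mul_mul_comm, ← Complex.exp_add]
    have : I * (P.1.1 * q.1 + P.1.2 * q.2 : ℝ) + -I * (P.2.1 * q.1 + P.2.2 * q.2 : ℝ) =
        I * ((P.1 - P.2).1 * q.1 + (P.1 - P.2).2 * q.2 : ℝ) := by
      push_cast [Prod.fst_sub, Prod.snd_sub]; ring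
    rw [this]
    ring
  have e2 : ((∫ q, ‖planeFourier f q‖ ^ 2 * rexp (-δ * (q.1 ^ 2 + q.2 ^ 2)) : ℝ) : ℂ) =
      ∫ P : (ℝ × ℝ) × (ℝ × ℝ), (f P.1 * (starRingEnd ℂ) (f P.2)) *
        (π / δ * rexp (-(1 / (4 * δ)) * ((P.1 - P.2).1 ^ 2 + (P.1 - P.2).2 ^ 2)) : ℝ) := by
    rw [← integral_complex_ofReal]
    simp_rw [e1]
    rw [← integral_integral_swap hKi]
    congr 1 with P
    rw [hK]
    simp only
    rw [integral_const_mul, integral_gaussian_plane hδ (P.1 - P.2)]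
  obtain ⟨i1, v1⟩ := integral_mul_gaussian_sub hf2 hδ
  have i2 : Integrable fun P : (ℝ × ℝ) × (ℝ × ℝ) => ‖f P.1‖ ^ 2 *
      (π / δ * rexp (-(1 / (4 * δ)) * ((P.2 - P.1).1 ^ 2 + (P.2 - P.1).2 ^ 2))) := i1.swap
  have v2 := integral_prod_swap (μ := (volume : Measure (ℝ × ℝ))) (ν := (volume : Measure (ℝ × ℝ)))
    (fun P : (ℝ × ℝ) × (ℝ × ℝ) => ‖f P.2‖ ^ 2 *
      (π / δ * rexp (-(1 / (4 * δ)) * ((P.1 - P.2).1 ^ 2 + (P.1 - P.2).2 ^ 2))))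
  rw [← Measure.volume_eq_prod, v1] at v2
  refine (le_abs_self _).trans ?_
  rw [← Real.norm_eq_abs, ← Complex.norm_real, e2]
  calc _ ≤ ∫ P : (ℝ × ℝ) × (ℝ × ℝ), (1 / 2 : ℝ) * (‖f P.2‖ ^ 2 *
      (π / δ * rexp (-(1 / (4 * δ)) * ((P.1 - P.2).1 ^ 2 + (P.1 - P.2).2 ^ 2))) +
      ‖f P.1‖ ^ 2 * (π / δ * rexp (-(1 / (4 * δ)) * ((P.2 - P.1).1 ^ 2 + (P.2 - P.1).2 ^ 2)))) := by
        refine norm_integral_le_of_norm_le ((i1.add i2).const_mul (1 / 2 : ℝ)) (ae_of_all _ fun P => ?_)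
        have : ((P.2 - P.1).1 ^ 2 + (P.2 - P.1).2 ^ 2) = ((P.1 - P.2).1 ^ 2 + (P.1 - P.2).2 ^ 2) := by
          simp only [Prod.fst_sub, Prod.snd_sub]; ring
        have hp : 0 ≤ π / δ *
            rexp (-(1 / (4 * δ)) * ((P.1 - P.2).1 ^ 2 + (P.1 - P.2).2 ^ 2)) := by positivity
        rw [this, norm_mul, norm_mul, RCLike.norm_conj, Complex.norm_real,
          Real.norm_of_nonneg hp, ← add_mul, ← mul_assoc (1 / 2 : ℝ)]
        refine mul_le_mul_of_nonneg_right ?_ hp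
        nlinarith [sq_nonneg (‖f P.1‖ - ‖f P.2‖)]
    _ = _ := by
        rw [integral_const_mul, integral_add i1 i2]
        have v2' := v2
        simp only [Prod.fst_swap, Prod.snd_swap] at v2'
        rw [v1, v2']
        ring

/-- Plancherel's inequality for the plane Fourier integral. -/
lemma integral_norm_planeFourier_sq_le {f : ℝ × ℝ → ℂ} (hfm : Measurable f) (hf : Integrable f)
    (hf2 : Integrable fun p => ‖f p‖ ^ 2) :
    (Integrable fun q => ‖planeFourier f q‖ ^ 2) ∧
      ∫ q, ‖planeFourier f q‖ ^ 2 ≤ (2 * π) ^ 2 * ∫ p, ‖f p‖ ^ 2 := by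
  have hF := measurable_planeFourier hfm
  have hδ : ∀ n : ℕ, (0 : ℝ) < 1 / ((n : ℝ) + 1) := fun n => by positivity
  refine integrable_and_integral_le_of_tendsto
    (h := fun n q => ‖planeFourier f q‖ ^ 2 * rexp (-(1 / ((n : ℝ) + 1)) * (q.1 ^ 2 + q.2 ^ 2)))
    (by fun_prop) (fun n => ?_) (fun n => by fun_prop) (fun n q => by positivity)
    (fun n => integral_norm_planeFourier_sq_mul_gaussian_le hf hf2 (hδ n)) (fun q => ?_)
  · refine (integrable_gaussian_plane (hδ n)).bdd_mul (c := (∫ p, ‖f p‖) ^ 2) (by fun_prop)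
      (ae_of_all _ fun q => ?_)
    rw [norm_pow, norm_norm]
    have := norm_planeFourier_le f q
    gcongr
  · have h := (((tendsto_one_div_add_atTop_nhds_zero_nat (𝕜 := ℝ)).neg.mul_const
      (q.1 ^ 2 + q.2 ^ 2)).rexp).const_mul (‖planeFourier f q‖ ^ 2)
    simpa using h

lemma exp_mul_le_add_of_mem_Icc {a b c : ℝ} (hac : a ≤ c) (hcb : c ≤ b) (L : ℝ) :
    rexp (c * L) ≤ rexp (a * L) + rexp (b * L) := by
  rcases le_total 0 L with h | h
  · have : rexp (c * L) ≤ rexp (b * L) := Real.exp_le_exp.2 (by gcongr)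
    linarith [Real.exp_pos (a * L)]
  · have : rexp (c * L) ≤ rexp (a * L) :=
      Real.exp_le_exp.2 (mul_le_mul_of_nonpos_right hac h)
    linarith [Real.exp_pos (b * L)]

lemma abs_mul_exp_mul_le {a b c d : ℝ} (hd : 0 < d) (hac : a + d ≤ c) (hcb : c + d ≤ b) (L : ℝ) :
    |L| * rexp (c * L) ≤ 2 / d * (rexp (a * L) + rexp (b * L)) := by
  have h1 : d * |L| ≤ rexp (d * |L|) := by linarith [Real.add_one_le_exp (d * |L|)]
  have h2 : rexp (d * |L|) ≤ rexp (d * L) + rexp (-d * L) := by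
    rcases abs_cases L with ⟨h, -⟩ | ⟨h, -⟩
    · rw [h]; linarith [Real.exp_pos (-d * L)]
    · rw [h, mul_neg, ← neg_mul]; linarith [Real.exp_pos (d * L)]
  have h3 := exp_mul_le_add_of_mem_Icc (a := a) (b := b) (c := d + c) (by linarith) (by linarith) L
  have h4 := exp_mul_le_add_of_mem_Icc (a := a) (b := b) (c := -d + c) (by linarith) (by linarith) L
  rw [add_mul, Real.exp_add] at h3 h4
  have h5 := Real.exp_pos (c * L)
  have h6 : d * (|L| * rexp (c * L)) ≤ 2 * (rexp (a * L) + rexp (b * L)) := by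
    nlinarith [mul_le_mul_of_nonneg_right (h1.trans h2) h5.le]
  rw [div_mul_eq_mul_div, le_div_iff₀ hd]
  linarith

section AnalyticFamily

variable {X : Type*} [MeasurableSpace X] {μ : Measure X} {H : X → ℂ} {L : X → ℝ} {a b : ℝ}

lemma norm_mul_cexp_mul_ofReal (h z : ℂ) (l : ℝ) : ‖h * cexp (z * l)‖ = ‖h‖ * rexp (z.re * l) := by
  rw [norm_mul, Complex.norm_exp, Complex.re_mul_ofReal]

lemma norm_mul_cexp_le {z : ℂ} (ha : a ≤ z.re) (hb : z.re ≤ b) (h : ℂ) (l : ℝ) :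
    ‖h * cexp (z * l)‖ ≤ ‖h‖ * rexp (a * l) + ‖h‖ * rexp (b * l) := by
  rw [norm_mul_cexp_mul_ofReal, ← mul_add]
  exact mul_le_mul_of_nonneg_left (exp_mul_le_add_of_mem_Icc ha hb l) (norm_nonneg _)

lemma integrable_mul_cexp (hH : Measurable H) (hL : Measurable L)
    (hia : Integrable (fun x => ‖H x‖ * rexp (a * L x)) μ)
    (hib : Integrable (fun x => ‖H x‖ * rexp (b * L x)) μ) {z : ℂ} (ha : a ≤ z.re) (hb : z.re ≤ b) :
    Integrable (fun x => H x * cexp (z * L x)) μ :=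
  (hia.add hib).mono' (by fun_prop) (ae_of_all _ fun x => norm_mul_cexp_le ha hb (H x) (L x))

lemma differentiableAt_integral_mul_cexp (hH : Measurable H) (hL : Measurable L)
    (hia : Integrable (fun x => ‖H x‖ * rexp (a * L x)) μ)
    (hib : Integrable (fun x => ‖H x‖ * rexp (b * L x)) μ) {z : ℂ} (ha : a < z.re) (hb : z.re < b) :
    DifferentiableAt ℂ (fun z => ∫ x, H x * cexp (z * L x) ∂μ) z := by
  obtain ⟨d, hd, hda, hdb⟩ : ∃ d > 0, a + d < z.re ∧ z.re < b - d := by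
    refine ⟨min (z.re - a) (b - z.re) / 2, ?_, ?_, ?_⟩
    · have := lt_min (sub_pos.2 ha) (sub_pos.2 hb); positivity
    · linarith [min_le_left (z.re - a) (b - z.re)]
    · linarith [min_le_right (z.re - a) (b - z.re)]
  have hs : {w : ℂ | a + d < w.re ∧ w.re < b - d} ∈ nhds z :=
    ((isOpen_lt continuous_const Complex.continuous_re).inter
      (isOpen_lt Complex.continuous_re continuous_const)).mem_nhds ⟨hda, hdb⟩
  refine (hasDerivAt_integral_of_dominated_loc_of_deriv_le (μ := μ)
    (F' := fun w x => H x * (cexp (w * L x) * (L x : ℂ)))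
    (bound := fun x => 2 / d * (‖H x‖ * rexp (a * L x) + ‖H x‖ * rexp (b * L x))) hs
    (Filter.Eventually.of_forall fun w => by fun_prop)
    (integrable_mul_cexp hH hL hia hib ha.le hb.le) (by fun_prop)
    (ae_of_all _ fun x w hw => ?_) ((hia.add hib).const_mul _)
    (ae_of_all _ fun x w hw => ?_)).2.differentiableAt
  · rw [← mul_assoc, norm_mul, norm_mul_cexp_mul_ofReal, Complex.norm_real, Real.norm_eq_abs]
    have := abs_mul_exp_mul_le hd hw.1.le (by linarith [hw.2]) (L x) (b := b)
    calc ‖H x‖ * rexp (w.re * L x) * |L x| = ‖H x‖ * (|L x| * rexp (w.re * L x)) := by ring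
      _ ≤ ‖H x‖ * (2 / d * (rexp (a * L x) + rexp (b * L x))) := by gcongr
      _ = _ := by ring
  · have := (((hasDerivAt_id w).mul_const (L x : ℂ)).cexp).const_mul (H x)
    simpa using this

/-- Stein interpolation for an exponential family, with linear growth allowed on `re z = 1`. -/
lemma norm_integral_mul_cexp_le_interp (hH : Measurable H) (hL : Measurable L)
    (ha : a < 0) (hb : 1 < b)
    (hia : Integrable (fun x => ‖H x‖ * rexp (a * L x)) μ)
    (hib : Integrable (fun x => ‖H x‖ * rexp (b * L x)) μ) {A B : ℝ} (hA0 : 0 ≤ A) (hB0 : 0 ≤ B)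
    (hA : ∀ z : ℂ, z.re = 0 → ‖∫ x, H x * cexp (z * L x) ∂μ‖ ≤ A)
    (hB : ∀ z : ℂ, z.re = 1 → ‖∫ x, H x * cexp (z * L x) ∂μ‖ ≤ B * (1 + |z.im|))
    {s : ℝ} (hs0 : 0 ≤ s) (hs1 : s ≤ 1) :
    ‖∫ x, H x * cexp ((s : ℂ) * L x) ∂μ‖ ≤ 6 * (A ^ (1 - s) * B ^ s) := by
  set F : ℂ → ℂ := fun z => ∫ x, H x * cexp (z * L x) ∂μ with hF
  have hexp : ∀ z : ℂ, ‖cexp (z ^ 2)‖ = rexp (z.re ^ 2 - z.im ^ 2) := by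
    intro z
    rw [Complex.norm_exp]
    congr 1
    simp [sq]
  have hdiff : ∀ z : ℂ, a < z.re → z.re < b → DifferentiableAt ℂ (fun z => F z * cexp (z ^ 2)) z :=
    fun z h1 h2 => (differentiableAt_integral_mul_cexp hH hL hia hib h1 h2).mul (by fun_prop)
  have hcl : closure (Complex.HadamardThreeLines.verticalStrip 0 1) ⊆ {z : ℂ | a < z.re ∧ z.re < b} := by
    have h1 : closure (Complex.HadamardThreeLines.verticalStrip 0 1) ⊆
        Complex.re ⁻¹' (Set.Icc 0 1) :=
      closure_minimal (Set.preimage_mono Set.Ioo_subset_Icc_self)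
        (isClosed_Icc.preimage Complex.continuous_re)
    exact h1.trans fun z hz => ⟨by linarith [hz.1], by linarith [hz.2]⟩
  have hd : DiffContOnCl ℂ (fun z => F z * cexp (z ^ 2))
      (Complex.HadamardThreeLines.verticalStrip 0 1) := by
    refine DifferentiableOn.diffContOnCl fun z hz => ?_
    exact (hdiff z (hcl hz).1 (hcl hz).2).differentiableWithinAt
  set S := ∫ x, (‖H x‖ * rexp (a * L x) + ‖H x‖ * rexp (b * L x)) ∂μ with hS
  have hbdd : BddAbove ((norm ∘ fun z => F z * cexp (z ^ 2)) ''
      Complex.HadamardThreeLines.verticalClosedStrip 0 1) := by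
    refine ⟨S * rexp 1, ?_⟩
    rintro _ ⟨z, hz, rfl⟩
    have hz0 : 0 ≤ z.re := hz.1
    have hz1 : z.re ≤ 1 := hz.2
    simp only [Function.comp_apply, norm_mul, hexp]
    have h1 : ‖F z‖ ≤ S := norm_integral_le_of_norm_le (hia.add hib)
      (ae_of_all _ fun x => norm_mul_cexp_le (by linarith) (by linarith) (H x) (L x))
    have h2 : z.re ^ 2 - z.im ^ 2 ≤ 1 := by nlinarith [sq_nonneg z.im]
    exact mul_le_mul h1 (Real.exp_le_exp.2 h2) (Real.exp_pos _).le ((norm_nonneg _).trans h1)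
  have key := Complex.HadamardThreeLines.norm_le_interp_of_mem_verticalClosedStrip₀₁'
    (fun z => F z * cexp (z ^ 2)) (z := (s : ℂ)) (a := A) (b := 2 * rexp 1 * B)
    (by simp [Complex.HadamardThreeLines.verticalClosedStrip, hs0, hs1]) hd hbdd
    (fun z hz => ?_) (fun z hz => ?_)
  · rw [norm_mul, hexp, Complex.ofReal_re, Complex.ofReal_im] at key
    have h1 : 1 ≤ rexp (s ^ 2 - 0 ^ 2) := Real.one_le_exp (by nlinarith [sq_nonneg s])
    have h2 : (2 * rexp 1 * B) ^ s ≤ 6 * B ^ s := by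
      rw [Real.mul_rpow (by positivity) hB0]
      have he : 2 * rexp 1 ≤ 6 := by linarith [Real.exp_one_lt_d9]
      have : (2 * rexp 1) ^ s ≤ 6 :=
        (Real.rpow_le_rpow_of_exponent_le (by linarith [Real.exp_one_gt_d9]) hs1).trans
          (by rwa [Real.rpow_one])
      gcongr
    calc ‖F s‖ ≤ ‖F s‖ * rexp (s ^ 2 - 0 ^ 2) := le_mul_of_one_le_right (norm_nonneg _) h1
      _ ≤ A ^ (1 - s) * (2 * rexp 1 * B) ^ s := key
      _ ≤ A ^ (1 - s) * (6 * B ^ s) := by gcongr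
      _ = _ := by ring
  · have hz : z.re = 0 := hz
    rw [norm_mul, hexp, hz]
    have h1 : rexp (0 ^ 2 - z.im ^ 2) ≤ 1 := Real.exp_le_one_iff.2 (by nlinarith [sq_nonneg z.im])
    calc _ ≤ A * 1 := mul_le_mul (hA z hz) h1 (Real.exp_pos _).le hA0
      _ = A := mul_one A
  · have hz : z.re = 1 := hz
    rw [norm_mul, hexp, hz, sub_eq_add_neg, Real.exp_add, one_pow]
    have h1 : (1 + |z.im|) * rexp (-z.im ^ 2) ≤ 2 := by
      rw [Real.exp_neg, ← div_eq_mul_inv, div_le_iff₀ (Real.exp_pos _)]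
      nlinarith [Real.add_one_le_exp (z.im ^ 2), sq_abs z.im, sq_nonneg (|z.im| - 1)]
    calc ‖F z‖ * (rexp 1 * rexp (-z.im ^ 2))
        ≤ (B * (1 + |z.im|)) * (rexp 1 * rexp (-z.im ^ 2)) := by gcongr; exact hB z hz
      _ = rexp 1 * B * ((1 + |z.im|) * rexp (-z.im ^ 2)) := by ring
      _ ≤ rexp 1 * B * 2 := by gcongr
      _ = _ := by ring

end AnalyticFamily

lemma integrable_trilinear {m F G : ℝ × ℝ → ℂ} (hm : Integrable m) (hF : Integrable F)
    (hG : Integrable G) :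
    Integrable fun P : (ℝ × ℝ) × ((ℝ × ℝ) × (ℝ × ℝ)) => m P.1 *
      cexp (I * ((P.2.2 - P.2.1).1 * P.1.1 + (P.2.2 - P.2.1).2 * P.1.2 : ℝ)) *
        (F P.2.1 * G P.2.2) := by
  have h : Integrable (fun P : (ℝ × ℝ) × ((ℝ × ℝ) × (ℝ × ℝ)) => m P.1 * (F P.2.1 * G P.2.2)) :=
    hm.mul_prod (hF.mul_prod hG)
  refine (h.bdd_mul (c := 1) (f := fun P : (ℝ × ℝ) × ((ℝ × ℝ) × (ℝ × ℝ)) =>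
    cexp (I * ((P.2.2 - P.2.1).1 * P.1.1 + (P.2.2 - P.2.1).2 * P.1.2 : ℝ))) (by fun_prop)
    (ae_of_all _ fun P => ?_)).congr (ae_of_all _ fun P => ?_)
  · rw [norm_exp_I_mul_ofReal]
  · ring

lemma integral_trilinear_eq_fourier {m F G : ℝ × ℝ → ℂ} (hm : Integrable m) (hF : Integrable F)
    (hG : Integrable G) :
    ∫ P : (ℝ × ℝ) × ((ℝ × ℝ) × (ℝ × ℝ)), m P.1 *
      cexp (I * ((P.2.2 - P.2.1).1 * P.1.1 + (P.2.2 - P.2.1).2 * P.1.2 : ℝ)) *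
        (F P.2.1 * G P.2.2) = ∫ q, m q * (planeFourier F (-q) * planeFourier G q) := by
  have hi := integrable_trilinear hm hF hG
  rw [Measure.volume_eq_prod, integral_prod _ (by rwa [← Measure.volume_eq_prod])]
  congr 1 with q
  have e : ∀ y : (ℝ × ℝ) × (ℝ × ℝ), m q * cexp (I * ((y.2 - y.1).1 * q.1 + (y.2 - y.1).2 * q.2 : ℝ)) *
      (F y.1 * G y.2) = m q * ((cexp (I * (y.1.1 * (-q).1 + y.1.2 * (-q).2 : ℝ)) * F y.1) *
        (cexp (I * (y.2.1 * q.1 + y.2.2 * q.2 : ℝ)) * G y.2)) := by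
    intro y
    have : cexp (I * ((y.2 - y.1).1 * q.1 + (y.2 - y.1).2 * q.2 : ℝ)) =
        cexp (I * (y.1.1 * (-q).1 + y.1.2 * (-q).2 : ℝ)) *
          cexp (I * (y.2.1 * q.1 + y.2.2 * q.2 : ℝ)) := by
      rw [← Complex.exp_add]
      congr 1
      simp only [Prod.fst_sub, Prod.snd_sub, Prod.fst_neg, Prod.snd_neg]
      push_cast
      ring
    rw [this]
    ring
  simp_rw [e]
  rw [integral_const_mul, Measure.volume_eq_prod, integral_prod_mul
    (fun p : ℝ × ℝ => cexp (I * (p.1 * (-q).1 + p.2 * (-q).2 : ℝ)) * F p)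
    (fun p : ℝ × ℝ => cexp (I * (p.1 * q.1 + p.2 * q.2 : ℝ)) * G p)]
  rfl

lemma integral_trilinear_eq_kernel {m F G : ℝ × ℝ → ℂ} (hm : Integrable m) (hF : Integrable F)
    (hG : Integrable G) :
    ∫ P : (ℝ × ℝ) × ((ℝ × ℝ) × (ℝ × ℝ)), m P.1 *
      cexp (I * ((P.2.2 - P.2.1).1 * P.1.1 + (P.2.2 - P.2.1).2 * P.1.2 : ℝ)) *
        (F P.2.1 * G P.2.2) = ∫ y : (ℝ × ℝ) × (ℝ × ℝ), (F y.1 * G y.2) *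
          ∫ q : ℝ × ℝ, cexp (I * ((y.2 - y.1).1 * q.1 + (y.2 - y.1).2 * q.2 : ℝ)) * m q := by
  have hi := integrable_trilinear hm hF hG
  rw [Measure.volume_eq_prod, integral_prod_symm _ (by rwa [← Measure.volume_eq_prod])]
  congr 1 with y
  rw [← integral_const_mul]
  congr 1 with q
  ring

lemma norm_trilinear_le_of_kernel {m F G : ℝ × ℝ → ℂ} (hm : Integrable m) (hF : Integrable F)
    (hG : Integrable G) {K : ℝ}
    (hK : ∀ y : ℝ × ℝ, ‖∫ q : ℝ × ℝ, cexp (I * (y.1 * q.1 + y.2 * q.2 : ℝ)) * m q‖ ≤ K) :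
    ‖∫ P : (ℝ × ℝ) × ((ℝ × ℝ) × (ℝ × ℝ)), m P.1 *
      cexp (I * ((P.2.2 - P.2.1).1 * P.1.1 + (P.2.2 - P.2.1).2 * P.1.2 : ℝ)) *
        (F P.2.1 * G P.2.2)‖ ≤ (∫ p, ‖F p‖) * (∫ p, ‖G p‖) * K := by
  rw [integral_trilinear_eq_kernel hm hF hG, ← integral_prod_mul, ← integral_mul_const]
  refine norm_integral_le_of_norm_le ((hF.norm.mul_prod hG.norm).mul_const K)
    (ae_of_all _ fun y => ?_)
  rw [norm_mul, norm_mul]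
  exact mul_le_mul_of_nonneg_left (hK (y.2 - y.1)) (by positivity)

lemma integral_mul_le_sqrt_mul_sqrt {X : Type*} [MeasurableSpace X] {μ : Measure X} {u v : X → ℝ}
    (hu : Measurable u) (hv : Measurable v) (hu0 : ∀ x, 0 ≤ u x) (hv0 : ∀ x, 0 ≤ v x)
    (hu2 : Integrable (fun x => u x ^ 2) μ) (hv2 : Integrable (fun x => v x ^ 2) μ) :
    ∫ x, u x * v x ∂μ ≤ √(∫ x, u x ^ 2 ∂μ) * √(∫ x, v x ^ 2 ∂μ) := by
  have h := integral_mul_le_Lp_mul_Lq_of_nonneg (μ := μ) (p := 2) (q := 2)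
    (by constructor <;> norm_num) (ae_of_all _ hu0) (ae_of_all _ hv0)
    (by simpa using (memLp_two_iff_integrable_sq hu.aestronglyMeasurable).2 hu2)
    (by simpa using (memLp_two_iff_integrable_sq hv.aestronglyMeasurable).2 hv2)
  simpa [Real.sqrt_eq_rpow] using h

lemma norm_trilinear_le_of_norm_le_one {m F G : ℝ × ℝ → ℂ} (hm : Integrable m)
    (hFm : Measurable F) (hGm : Measurable G) (hF : Integrable F)
    (hG : Integrable G) (hF2 : Integrable fun p => ‖F p‖ ^ 2) (hG2 : Integrable fun p => ‖G p‖ ^ 2)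
    (hm1 : ∀ q, ‖m q‖ ≤ 1) :
    ‖∫ P : (ℝ × ℝ) × ((ℝ × ℝ) × (ℝ × ℝ)), m P.1 *
      cexp (I * ((P.2.2 - P.2.1).1 * P.1.1 + (P.2.2 - P.2.1).2 * P.1.2 : ℝ)) *
        (F P.2.1 * G P.2.2)‖ ≤ (2 * π) ^ 2 * (√(∫ p, ‖F p‖ ^ 2) * √(∫ p, ‖G p‖ ^ 2)) := by
  rw [integral_trilinear_eq_fourier hm hF hG]
  obtain ⟨iF, bF⟩ := integral_norm_planeFourier_sq_le hFm hF hF2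
  obtain ⟨iG, bG⟩ := integral_norm_planeFourier_sq_le hGm hG hG2
  have iF' : Integrable fun q => ‖planeFourier F (-q)‖ ^ 2 := iF.comp_neg
  have bF' : ∫ q, ‖planeFourier F (-q)‖ ^ 2 ≤ (2 * π) ^ 2 * ∫ p, ‖F p‖ ^ 2 := by
    rwa [integral_neg_eq_self (fun q => ‖planeFourier F q‖ ^ 2)]
  have mF := measurable_planeFourier hFm
  have mG := measurable_planeFourier hGm
  have hi : Integrable fun q => ‖planeFourier F (-q)‖ * ‖planeFourier G q‖ := by
    refine (iF'.add iG).mono' (by fun_prop) (ae_of_all _ fun q => ?_)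
    rw [Real.norm_of_nonneg (by positivity), Pi.add_apply]
    nlinarith [sq_nonneg (‖planeFourier F (-q)‖ - ‖planeFourier G q‖),
      sq_nonneg ‖planeFourier F (-q)‖, sq_nonneg ‖planeFourier G q‖]
  calc _ ≤ ∫ q, ‖planeFourier F (-q)‖ * ‖planeFourier G q‖ := by
        refine norm_integral_le_of_norm_le hi (ae_of_all _ fun q => ?_)
        rw [norm_mul, norm_mul]
        exact mul_le_of_le_one_left (by positivity) (hm1 q)
    _ ≤ √(∫ q, ‖planeFourier F (-q)‖ ^ 2) * √(∫ q, ‖planeFourier G q‖ ^ 2) :=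
        integral_mul_le_sqrt_mul_sqrt (by fun_prop) (by fun_prop) (fun _ => norm_nonneg _)
          (fun _ => norm_nonneg _) iF' iG
    _ ≤ √((2 * π) ^ 2 * ∫ p, ‖F p‖ ^ 2) * √((2 * π) ^ 2 * ∫ p, ‖G p‖ ^ 2) := by gcongr
    _ = _ := by
        rw [Real.sqrt_mul (by positivity), Real.sqrt_mul (by positivity), Real.sqrt_sq (by positivity)]
        ring

/-- The analytic family `‖w‖ ^ ((1 + z) ρ / 2) * (w / ‖w‖)`. -/
noncomputable def phasePow (ρ : ℝ) (z w : ℂ) : ℂ :=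
  (‖w‖ ^ (ρ / 2) : ℝ) * (w / ‖w‖) * cexp (z * (ρ / 2 * Real.log ‖w‖ : ℝ))

lemma measurable_phasePow (ρ : ℝ) (z : ℂ) : Measurable (phasePow ρ z) := by
  unfold phasePow
  fun_prop

lemma norm_phasePow {ρ : ℝ} (hρ : 0 < ρ) {z : ℂ} (hz : -1 < z.re) (w : ℂ) :
    ‖phasePow ρ z w‖ = ‖w‖ ^ (ρ / 2 * (1 + z.re)) := by
  rcases eq_or_ne w 0 with rfl | hw
  · have h : 0 < ρ / 2 * (1 + z.re) := mul_pos (by positivity) (by linarith)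
    simp [phasePow, Real.zero_rpow h.ne']
  · have hw0 : 0 < ‖w‖ := norm_pos_iff.2 hw
    have e : rexp (z.re * (ρ / 2 * Real.log ‖w‖)) = ‖w‖ ^ (ρ / 2 * z.re) := by
      rw [Real.rpow_def_of_pos hw0]; congr 1; ring
    rw [phasePow, norm_mul_cexp_mul_ofReal, norm_mul, norm_div, Complex.norm_real,
      Complex.norm_real, norm_norm, div_self hw0.ne', mul_one, Real.norm_of_nonneg (by positivity), e,
      ← Real.rpow_add hw0]
    congr 1; ring

lemma phasePow_self {ρ s : ℝ} (h : ρ * (1 + s) / 2 = 1) (w : ℂ) : phasePow ρ s w = w := by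
  rcases eq_or_ne w 0 with rfl | hw
  · simp [phasePow]
  · have hw0 : 0 < ‖w‖ := norm_pos_iff.2 hw
    have e : rexp (s * (ρ / 2 * Real.log ‖w‖)) = ‖w‖ ^ (ρ / 2 * s) := by
      rw [Real.rpow_def_of_pos hw0]; congr 1; ring
    rw [phasePow, ← Complex.ofReal_mul, ← Complex.ofReal_exp, e, mul_right_comm,
      ← Complex.ofReal_mul, ← Real.rpow_add hw0, show ρ / 2 + ρ / 2 * s = 1 by linarith, Real.rpow_one]
    have hne : (‖w‖ : ℂ) ≠ 0 := by exact_mod_cast hw0.ne'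
    field_simp

lemma kpSymbol_eq_mul_cexp (α t ε : ℝ) (z : ℂ) (q : ℝ × ℝ) :
    kpSymbol α t ε z q =
      kpSymbol α t ε 0 q * cexp (z * (-(1 - α / 2) * Real.log |q.1| : ℝ)) := by
  simp [kpSymbol]

lemma norm_kpSymbol_le_one {α t ε : ℝ} (hε : 0 ≤ ε) {z : ℂ} (hz : z.re = 0) (q : ℝ × ℝ) :
    ‖kpSymbol α t ε z q‖ ≤ 1 := by
  rw [norm_kpSymbol, hz, zero_mul, Real.exp_zero, mul_one, Real.exp_le_one_iff, neg_nonpos]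
  positivity

/-- Bilinear form of the interpolated estimate for the regularised multiplier. -/
lemma exists_norm_bilinear_le {α : ℝ} (hα1 : 4 / 3 < α) (hα2 : α ≤ 6) {s ρ : ℝ} (hs0 : 0 ≤ s)
    (hs1 : s ≤ 1) (hρ : 0 < ρ) (hρs : ρ * (1 + s) / 2 = 1) :
    ∃ C > 0, ∀ t ε : ℝ, t ≠ 0 → 0 < ε → ∀ f g : ℝ × ℝ → ℂ, Measurable f → Measurable g →
      (∀ κ : ℝ, 0 < κ → Integrable fun p => ‖f p‖ ^ κ) →
      (∀ κ : ℝ, 0 < κ → Integrable fun p => ‖g p‖ ^ κ) →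
      ‖∫ q, kpSymbol α t ε s q * (planeFourier f (-q) * planeFourier g q)‖ ≤
        C * |t| ^ (-s) * (∫ p, ‖f p‖ ^ ρ) ^ (1 / ρ) * (∫ p, ‖g p‖ ^ ρ) ^ (1 / ρ) := by
  obtain ⟨C, hC, hker⟩ := exists_norm_kernel_le (α := α) (by linarith)
  refine ⟨6 * (((2 * π) ^ 2) ^ (1 - s) * C ^ s), by positivity,
    fun t ε ht hε f g hfm hgm hf hg => ?_⟩
  have hphase : ∀ {u : ℝ × ℝ → ℂ}, Measurable u → (∀ κ : ℝ, 0 < κ → Integrable fun p => ‖u p‖ ^ κ) →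
      ∀ {z : ℂ}, -1 < z.re → Measurable (fun p => phasePow ρ z (u p)) ∧
        Integrable fun p => phasePow ρ z (u p) := by
    intro u hum hu z hz
    have hm : Measurable (fun p => phasePow ρ z (u p)) := (measurable_phasePow ρ z).comp hum
    refine ⟨hm, (integrable_norm_iff hm.aestronglyMeasurable).1 ?_⟩
    simp_rw [norm_phasePow hρ hz]
    exact hu _ (mul_pos (by positivity) (by linarith))
  set H : (ℝ × ℝ) × ((ℝ × ℝ) × (ℝ × ℝ)) → ℂ := fun P => kpSymbol α t ε 0 P.1 *
    cexp (I * ((P.2.2 - P.2.1).1 * P.1.1 + (P.2.2 - P.2.1).2 * P.1.2 : ℝ)) *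
      (phasePow ρ 0 (f P.2.1) * phasePow ρ 0 (g P.2.2)) with hH
  set L : (ℝ × ℝ) × ((ℝ × ℝ) × (ℝ × ℝ)) → ℝ := fun P => -(1 - α / 2) * Real.log |P.1.1| +
    ρ / 2 * Real.log ‖f P.2.1‖ + ρ / 2 * Real.log ‖g P.2.2‖ with hL
  have hHL : ∀ z P, H P * cexp (z * L P) = kpSymbol α t ε z P.1 *
    cexp (I * ((P.2.2 - P.2.1).1 * P.1.1 + (P.2.2 - P.2.1).2 * P.1.2 : ℝ)) *
      (phasePow ρ z (f P.2.1) * phasePow ρ z (g P.2.2)) := by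
    intro z P
    have e : ∀ w, phasePow ρ z w = phasePow ρ 0 w * cexp (z * (ρ / 2 * Real.log ‖w‖ : ℝ)) := by
      intro w; simp [phasePow]
    rw [kpSymbol_eq_mul_cexp α t ε z, e, e, hH, hL]
    simp only
    have e' : ∀ a b c : ℝ, cexp (z * (a + b + c : ℝ)) =
        cexp (z * a) * cexp (z * b) * cexp (z * c) := by
      intro a b c
      rw [← Complex.exp_add, ← Complex.exp_add]
      push_cast
      ring_nf
    rw [e']
    ring
  have hm0 := measurable_kpSymbol α t ε 0
  have hmp := measurable_phasePow ρ 0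
  have hHm : Measurable H := by
    refine Measurable.mul (Measurable.mul (hm0.comp measurable_fst) (by fun_prop)) (Measurable.mul ?_ ?_)
    · exact hmp.comp (hfm.comp measurable_snd.fst)
    · exact hmp.comp (hgm.comp measurable_snd.snd)
  have hLm : Measurable L := by fun_prop
  have hint : ∀ c : ℝ, -1 < c → -1 < 1 / 2 - c * (1 - α / 2) →
      Integrable fun P => ‖H P‖ * rexp (c * L P) := by
    intro c hc1 hc2
    have h := (integrable_trilinear (integrable_kpSymbol (α := α) t hε (z := (c : ℂ)) (by simpa using hc2))
      (hphase hfm hf (z := (c : ℂ)) (by simpa using hc1)).2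
      (hphase hgm hg (z := (c : ℂ)) (by simpa using hc1)).2).norm
    refine h.congr (ae_of_all _ fun P => ?_)
    simp only
    rw [← hHL, norm_mul_cexp_mul_ofReal, Complex.ofReal_re]
  set Nf := ∫ p, ‖f p‖ ^ ρ with hNf
  set Ng := ∫ p, ‖g p‖ ^ ρ with hNg
  have hNf0 : 0 ≤ Nf := integral_nonneg fun p => by positivity
  have hNg0 : 0 ≤ Ng := integral_nonneg fun p => by positivity
  have key := norm_integral_mul_cexp_le_interp hHm hLm (a := -(1 / 8)) (b := 9 / 8) (by norm_num)
    (by norm_num) (hint _ (by norm_num) (by linarith)) (hint _ (by norm_num) (by linarith))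
    (A := (2 * π) ^ 2 * (√Nf * √Ng)) (B := Nf * Ng * (C * |t|⁻¹)) (by positivity) (by positivity)
    (fun z hz => ?_) (fun z hz => ?_) hs0 hs1
  · have hsre : -1 < (s : ℂ).re := by rw [Complex.ofReal_re]; linarith
    simp_rw [hHL] at key
    rw [integral_trilinear_eq_fourier (integrable_kpSymbol t hε
      (by rw [Complex.ofReal_re]; nlinarith)) (hphase hfm hf hsre).2 (hphase hgm hg hsre).2] at key
    simp_rw [phasePow_self hρs] at key
    refine key.trans_eq ?_
    have ht0 : 0 < |t| := abs_pos.2 ht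
    have hsum : ∀ x : ℝ, 0 ≤ x → x ^ ((1 / 2) * (1 - s)) * x ^ s = x ^ (1 / ρ) := by
      intro x hx
      rw [← Real.rpow_add_of_nonneg hx (by linarith) hs0]
      congr 1
      field_simp
      linarith
    rw [Real.mul_rpow (by positivity) (by positivity), Real.mul_rpow (by positivity) (by positivity),
      Real.mul_rpow (by positivity) (by positivity), Real.mul_rpow hNf0 hNg0,
      Real.mul_rpow hC.le (by positivity), Real.sqrt_eq_rpow, Real.sqrt_eq_rpow, ← Real.rpow_mul hNf0,
      ← Real.rpow_mul hNg0, ← hsum Nf hNf0, ← hsum Ng hNg0, Real.inv_rpow ht0.le, ← Real.rpow_neg ht0.le]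
    ring
  · have hz1 : -1 < z.re := by rw [hz]; norm_num
    have hsq : ∀ w, ‖phasePow ρ z w‖ ^ 2 = ‖w‖ ^ ρ := by
      intro w
      rw [norm_phasePow hρ hz1, hz, ← Real.rpow_mul_natCast (norm_nonneg _)]
      congr 1
      push_cast; ring
    simp_rw [hHL]
    have h := norm_trilinear_le_of_norm_le_one (integrable_kpSymbol (α := α) t hε (z := z)
      (by rw [hz]; norm_num)) (hphase hfm hf hz1).1 (hphase hgm hg hz1).1 (hphase hfm hf hz1).2
      (hphase hgm hg hz1).2 (by simp_rw [hsq]; exact hf ρ hρ) (by simp_rw [hsq]; exact hg ρ hρ)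
      (norm_kpSymbol_le_one hε.le hz)
    simpa only [hsq] using h
  · have hz1 : -1 < z.re := by rw [hz]; norm_num
    have hn : ∀ w, ‖phasePow ρ z w‖ = ‖w‖ ^ ρ := by
      intro w
      rw [norm_phasePow hρ hz1, hz]
      congr 1
      ring
    simp_rw [hHL]
    have h := norm_trilinear_le_of_kernel (integrable_kpSymbol (α := α) t hε (z := z)
      (by rw [hz]; linarith)) (hphase hfm hf hz1).2 (hphase hgm hg hz1).2
      (hker t ε ht hε z hz)
    simp only [hn] at h
    calc _ ≤ _ := h
      _ = _ := by ring

/-- The unregularised multiplier of order `-s (1 - α / 2)`. -/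
noncomputable def kpMultiplier (α t s : ℝ) (q : ℝ × ℝ) : ℂ :=
  ((|q.1| ^ (-s * (1 - α / 2)) : ℝ) : ℂ) *
    cexp (I * ((t * (q.1 * |q.1| ^ α - q.2 ^ 2 / q.1) : ℝ) : ℂ))

lemma measurable_kpMultiplier (α t s : ℝ) : Measurable (kpMultiplier α t s) := by
  unfold kpMultiplier
  fun_prop

lemma kpSymbol_eq_exp_mul_kpMultiplier (α t ε s : ℝ) {q : ℝ × ℝ} (hq : q.1 ≠ 0) :
    kpSymbol α t ε s q =
      (rexp (-ε * (|q.1| + q.2 ^ 2 / |q.1|)) : ℝ) * kpMultiplier α t s q := by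
  have h1 : cexp ((s : ℂ) * (-(1 - α / 2) * Real.log |q.1| : ℝ)) =
      ((|q.1| ^ (-s * (1 - α / 2)) : ℝ) : ℂ) := by
    rw [← Complex.ofReal_mul, ← Complex.ofReal_exp, Real.rpow_def_of_pos (abs_pos.2 hq)]
    congr 2; ring
  have h2 : -(ε * |q.1| + ε * q.2 ^ 2 / |q.1|) = -ε * (|q.1| + q.2 ^ 2 / |q.1|) := by ring
  rw [kpSymbol, kpMultiplier, h1, h2]
  ring

lemma ae_fst_ne_zero : ∀ᵐ q : ℝ × ℝ, q.1 ≠ 0 := by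
  rw [Measure.volume_eq_prod]
  exact Measure.quasiMeasurePreserving_fst.ae (Measure.ae_ne volume 0)

/-- Bilinear form of the interpolated estimate. -/
lemma norm_integral_kpMultiplier_mul_le {α t s D : ℝ} {f g : ℝ × ℝ → ℂ} (hfm : Measurable f)
    (hgm : Measurable g)
    (hw : Integrable fun q => kpMultiplier α t s q * planeFourier f (-q))
    (hD : ∀ ε : ℝ, 0 < ε →
      ‖∫ q, kpSymbol α t ε s q * (planeFourier f (-q) * planeFourier g q)‖ ≤ D) :
    ‖∫ q, kpMultiplier α t s q * planeFourier f (-q) * planeFourier g q‖ ≤ D := by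
  have hF := measurable_planeFourier hfm
  have hG := measurable_planeFourier hgm
  have hlim : Filter.Tendsto (fun n : ℕ => ∫ q, kpSymbol α t (1 / ((n : ℝ) + 1)) s q *
      (planeFourier f (-q) * planeFourier g q)) Filter.atTop
      (nhds (∫ q, kpMultiplier α t s q * planeFourier f (-q) * planeFourier g q)) := by
    refine tendsto_integral_of_dominated_convergence
      (fun q => ‖kpMultiplier α t s q * planeFourier f (-q)‖ * ∫ p, ‖g p‖) (fun n => ?_)
      (hw.norm.mul_const _) (fun n => ?_) ?_
    · exact ((measurable_kpSymbol _ _ _ _).mul ((hF.comp measurable_neg).mul hG)).aestronglyMeasurable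
    · filter_upwards [ae_fst_ne_zero] with q hq
      rw [kpSymbol_eq_exp_mul_kpMultiplier _ _ _ _ hq]
      have h1 : ‖((rexp (-(1 / ((n : ℝ) + 1)) * (|q.1| + q.2 ^ 2 / |q.1|)) : ℝ) : ℂ)‖ ≤ 1 := by
        rw [Complex.norm_real, Real.norm_of_nonneg (Real.exp_pos _).le, Real.exp_le_one_iff,
          neg_mul, neg_nonpos]
        positivity
      rw [mul_assoc, norm_mul, ← mul_assoc, norm_mul _ (planeFourier g q)]
      calc _ ≤ 1 * (‖kpMultiplier α t s q * planeFourier f (-q)‖ * ∫ p, ‖g p‖) := by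
            gcongr
            exact norm_planeFourier_le g q
        _ = _ := one_mul _
    · filter_upwards [ae_fst_ne_zero] with q hq
      simp_rw [kpSymbol_eq_exp_mul_kpMultiplier _ _ _ _ hq]
      have h := ((tendsto_one_div_add_atTop_nhds_zero_nat (𝕜 := ℝ)).neg.mul_const
        (|q.1| + q.2 ^ 2 / |q.1|)).rexp
      rw [neg_zero, zero_mul, Real.exp_zero] at h
      have h' := ((Complex.continuous_ofReal.tendsto _).comp h).mul_const
        (kpMultiplier α t s q * planeFourier f (-q) * planeFourier g q)
      rw [Complex.ofReal_one, one_mul] at h'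
      refine h'.congr fun n => ?_
      simp only [Function.comp_apply]
      ring
  exact le_of_tendsto' hlim.norm fun n => hD _ (by positivity)

lemma integral_mul_planeFourier {w g : ℝ × ℝ → ℂ} (hw : Integrable w) (hg : Integrable g) :
    ∫ q, w q * planeFourier g q = ∫ x, g x * planeFourier w x := by
  have hi : Integrable (Function.uncurry fun q x : ℝ × ℝ =>
      cexp (I * (x.1 * q.1 + x.2 * q.2 : ℝ)) * (w q * g x)) (volume.prod volume) := by
    refine (hw.mul_prod hg).bdd_mul (c := 1) (by fun_prop) (ae_of_all _ fun P => ?_)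
    rw [norm_exp_I_mul_ofReal]
  have h := integral_integral_swap hi
  calc _ = ∫ q, ∫ x : ℝ × ℝ, cexp (I * (x.1 * q.1 + x.2 * q.2 : ℝ)) * (w q * g x) := by
        congr 1 with q
        rw [planeFourier, ← integral_const_mul]
        congr 1 with x
        ring
    _ = ∫ x, ∫ q : ℝ × ℝ, cexp (I * (x.1 * q.1 + x.2 * q.2 : ℝ)) * (w q * g x) := h
    _ = _ := by
        congr 1 with x
        rw [planeFourier, ← integral_const_mul]
        congr 1 with q
        rw [show x.1 * q.1 + x.2 * q.2 = q.1 * x.1 + q.2 * x.2 by ring]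
        ring

/-- Duality: testing a bounded function against compactly supported functions controls its
`L^r` norm. -/
lemma integral_norm_rpow_le_of_dual {v : ℝ × ℝ → ℂ} (hvm : Measurable v) {V : ℝ}
    (hV : ∀ x, ‖v x‖ ≤ V) {r D : ℝ} (hr : 2 ≤ r) (hD0 : 0 ≤ D)
    (hD : ∀ g : ℝ × ℝ → ℂ, Measurable g → (∀ κ : ℝ, 0 < κ → Integrable fun p => ‖g p‖ ^ κ) →
      ‖∫ x, g x * v x‖ ≤ D * (∫ x, ‖g x‖ ^ (r / (r - 1))) ^ ((r - 1) / r)) :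
    (∫ x, ‖v x‖ ^ r) ^ (1 / r) ≤ D := by
  have hr0 : 0 < r := by linarith
  have hr1 : 0 < r - 1 := by linarith
  set B : ℕ → Set (ℝ × ℝ) := fun n => Metric.ball 0 n with hB
  have hBm : ∀ n, MeasurableSet (B n) := fun n => Metric.isOpen_ball.measurableSet
  have hpow : ∀ κ : ℝ, 0 < κ → ∀ n, Integrable ((B n).indicator fun x => ‖v x‖ ^ κ) := by
    intro κ hκ n
    rw [integrable_indicator_iff (hBm n)]
    refine Measure.integrableOn_of_bounded (M := V ^ κ) measure_ball_lt_top.ne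
      (by fun_prop : Measurable fun x => ‖v x‖ ^ κ).aestronglyMeasurable
      (ae_of_all _ fun x => ?_)
    rw [Real.norm_of_nonneg (by positivity)]
    exact Real.rpow_le_rpow (norm_nonneg _) (hV x) hκ.le
  have hbound : ∀ n, ∫ x, (B n).indicator (fun x => ‖v x‖ ^ r) x ≤ D ^ r := by
    intro n
    set J := ∫ x, (B n).indicator (fun x => ‖v x‖ ^ r) x with hJ
    have hJ0 : 0 ≤ J := integral_nonneg fun x => Set.indicator_nonneg (fun _ _ => by positivity) x
    set g : ℝ × ℝ → ℂ := (B n).indicator fun x => ((‖v x‖ ^ (r - 2) : ℝ) : ℂ) *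
      (starRingEnd ℂ) (v x) with hg
    have hgm : Measurable g := by
      refine Measurable.indicator ?_ (hBm n)
      exact (by fun_prop : Measurable fun x => ((‖v x‖ ^ (r - 2) : ℝ) : ℂ)).mul
        (Complex.continuous_conj.measurable.comp hvm)
    have hgn : ∀ κ : ℝ, 0 < κ → ∀ x, ‖g x‖ ^ κ =
        (B n).indicator (fun x => ‖v x‖ ^ ((r - 1) * κ)) x := by
      intro κ hκ x
      by_cases hx : x ∈ B n
      · rw [hg, Set.indicator_of_mem hx, Set.indicator_of_mem hx, norm_mul, RCLike.norm_conj,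
          Complex.norm_real, Real.norm_of_nonneg (by positivity), Real.rpow_mul (norm_nonneg _)]
        congr 1
        rw [← Real.rpow_add_one' (norm_nonneg _) (by linarith)]
        congr 1; ring
      · rw [hg, Set.indicator_of_notMem hx, Set.indicator_of_notMem hx, norm_zero,
          Real.zero_rpow hκ.ne']
    have hgi : ∀ κ : ℝ, 0 < κ → Integrable fun p => ‖g p‖ ^ κ := by
      intro κ hκ
      simp_rw [hgn κ hκ]
      exact hpow _ (by positivity) n
    have hgv : ∀ x, g x * v x = (((B n).indicator (fun x => ‖v x‖ ^ r) x : ℝ) : ℂ) := by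
      intro x
      by_cases hx : x ∈ B n
      · rw [hg, Set.indicator_of_mem hx, Set.indicator_of_mem hx, mul_assoc, mul_comm _ (v x),
          Complex.mul_conj, Complex.normSq_eq_norm_sq, ← Complex.ofReal_mul, ← Real.rpow_natCast,
          ← Real.rpow_add' (norm_nonneg _) (by push_cast; linarith)]
        congr 2; push_cast; ring
      · rw [hg, Set.indicator_of_notMem hx, Set.indicator_of_notMem hx, zero_mul, Complex.ofReal_zero]
    have key := hD g hgm hgi
    simp_rw [hgv, hgn (r / (r - 1)) (by positivity), show (r - 1) * (r / (r - 1)) = r by field_simp]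
      at key
    rw [integral_complex_ofReal, Complex.norm_real, Real.norm_of_nonneg hJ0, ← hJ] at key
    rcases hJ0.eq_or_lt with h | h
    · rw [← h]; positivity
    · have e : J = J ^ (1 / r) * J ^ ((r - 1) / r) := by
        rw [← Real.rpow_add h, show 1 / r + (r - 1) / r = 1 by field_simp; ring, Real.rpow_one]
      have h1 : J ^ (1 / r) ≤ D := by
        refine le_of_mul_le_mul_right ?_ (Real.rpow_pos_of_pos h ((r - 1) / r))
        rwa [← e]
      calc J = (J ^ (1 / r)) ^ r := by
            rw [← Real.rpow_mul hJ0, one_div_mul_cancel hr0.ne', Real.rpow_one]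
        _ ≤ D ^ r := by gcongr
  obtain ⟨-, h⟩ := integrable_and_integral_le_of_tendsto (μ := (volume : Measure (ℝ × ℝ)))
    (g := fun x => ‖v x‖ ^ r)
    (h := fun n => (B n).indicator (fun x => ‖v x‖ ^ r)) (M := D ^ r) (by fun_prop)
    (hpow r hr0) (fun n => Measurable.indicator (by fun_prop) (hBm n))
    (fun n x => Set.indicator_nonneg (fun _ _ => by positivity) x) hbound (fun x => by
      refine tendsto_const_nhds.congr' ?_
      obtain ⟨N, hN⟩ := exists_nat_gt ‖x‖
      filter_upwards [Filter.eventually_ge_atTop N] with n hn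
      rw [Set.indicator_of_mem]
      have : (N : ℝ) ≤ n := by exact_mod_cast hn
      simp only [hB, Metric.mem_ball, dist_zero_right]
      linarith)
  calc _ ≤ (D ^ r) ^ (1 / r) := by
        gcongr
    _ = D := by rw [← Real.rpow_mul hD0, mul_one_div_cancel hr0.ne', Real.rpow_one]

lemma integrable_norm_rpow_schwartzMap (u : SchwartzMap (ℝ × ℝ) ℂ) {κ : ℝ} (hκ : 0 < κ) :
    Integrable fun p => ‖u p‖ ^ κ := by
  have h := (u.memLp (ENNReal.ofReal κ) volume).integrable_norm_rpow
    (by simpa using hκ) ENNReal.ofReal_ne_top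
  rwa [ENNReal.toReal_ofReal hκ.le] at h

/-- Interpolated decay estimate `‖v_r‖_{L^r} ≤ C |t|^{2/r-1} ‖u₀‖_{L^{r'}}`
for `2 ≤ r < ∞`, `r' = r/(r-1)`, `θ = 1 - α/2`, where
`v_r(x,y) = ∫ e^{i(xξ+yη)} |ξ|^{(2/r-1)θ} e^{it(ξ|ξ|^α - η²/ξ)} û₀(ξ,η) dξdη`. -/
theorem interpolated_decay_estimate (α r : ℝ) (hα1 : 4 / 3 < α) (hα2 : α ≤ 6)
    (hr : 2 ≤ r) :
    ∃ C > 0, ∀ (u₀ : SchwartzMap (ℝ × ℝ) ℂ) (t : ℝ), t ≠ 0 →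
      (∫ z : ℝ × ℝ,
          ‖∫ q : ℝ × ℝ,
              Complex.exp (Complex.I * ((z.1 * q.1 + z.2 * q.2 : ℝ) : ℂ)) *
              ((|q.1| ^ ((2 / r - 1) * (1 - α / 2)) : ℝ) : ℂ) *
              Complex.exp (Complex.I *
                ((t * (q.1 * |q.1| ^ α - q.2 ^ 2 / q.1) : ℝ) : ℂ)) *
              (∫ p : ℝ × ℝ,
                Complex.exp (-Complex.I * ((p.1 * q.1 + p.2 * q.2 : ℝ) : ℂ)) * u₀ p)‖
            ^ r) ^ (1 / r)
        ≤ C * |t| ^ (2 / r - 1) *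
            (∫ p : ℝ × ℝ, ‖u₀ p‖ ^ (r / (r - 1))) ^ ((r - 1) / r) := by
  have hr0 : 0 < r := by linarith
  have hr1 : 0 < r - 1 := by linarith
  have h2r : 2 / r ≤ 1 := (div_le_one hr0).2 hr
  have h2r0 : 0 < 2 / r := by positivity
  obtain ⟨C, hC, hbil⟩ := exists_norm_bilinear_le hα1 hα2 (s := 1 - 2 / r) (ρ := r / (r - 1))
    (by linarith) (by linarith) (by positivity) (by field_simp; ring)
  refine ⟨C, hC, fun u₀ t ht => ?_⟩
  have hum : Measurable u₀ := u₀.continuous.measurable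
  set w : ℝ × ℝ → ℂ := fun q => kpMultiplier α t (1 - 2 / r) q * planeFourier u₀ (-q) with hw
  have hwm : Measurable w := (measurable_kpMultiplier _ _ _).mul
    ((measurable_planeFourier hum).comp measurable_neg)
  have hv : ∀ z : ℝ × ℝ, (∫ q : ℝ × ℝ,
      Complex.exp (Complex.I * ((z.1 * q.1 + z.2 * q.2 : ℝ) : ℂ)) *
      ((|q.1| ^ ((2 / r - 1) * (1 - α / 2)) : ℝ) : ℂ) *
      Complex.exp (Complex.I * ((t * (q.1 * |q.1| ^ α - q.2 ^ 2 / q.1) : ℝ) : ℂ)) *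
      (∫ p : ℝ × ℝ, Complex.exp (-Complex.I * ((p.1 * q.1 + p.2 * q.2 : ℝ) : ℂ)) * u₀ p)) =
      planeFourier w z := by
    intro z
    rw [planeFourier]
    congr 1 with q
    have e : (∫ p : ℝ × ℝ, Complex.exp (-Complex.I * ((p.1 * q.1 + p.2 * q.2 : ℝ) : ℂ)) * u₀ p) =
        planeFourier u₀ (-q) := by
      rw [planeFourier]
      congr 1 with p
      congr 2
      simp only [Prod.fst_neg, Prod.snd_neg]
      push_cast; ring
    simp only [hw, e, kpMultiplier]
    rw [neg_sub, mul_comm z.1, mul_comm z.2]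
    ring
  simp_rw [hv]
  by_cases hwi : Integrable w
  · refine integral_norm_rpow_le_of_dual (measurable_planeFourier hwm) (norm_planeFourier_le w) hr
      (by positivity) fun g hgm hg => ?_
    have hgi : Integrable g := (integrable_norm_iff hgm.aestronglyMeasurable).1
      (by simpa using hg 1 one_pos)
    rw [← integral_mul_planeFourier hwi hgi]
    refine norm_integral_kpMultiplier_mul_le hum hgm hwi fun ε hε => ?_
    have h := hbil t ε ht hε u₀ g hum hgm (fun κ hκ => integrable_norm_rpow_schwartzMap u₀ hκ) hg
    rwa [neg_sub, one_div_div] at h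
  · have h0 : ∀ z, planeFourier w z = 0 := by
      intro z
      refine integral_undef fun h => hwi ?_
      refine (h.bdd_mul (c := 1) (f := fun q : ℝ × ℝ => cexp (I * (-(q.1 * z.1 + q.2 * z.2) : ℝ)))
        (by fun_prop) (ae_of_all _ fun q => ?_)).congr (ae_of_all _ fun q => ?_)
      · rw [norm_exp_I_mul_ofReal]
      · simp only
        rw [← mul_assoc, ← Complex.exp_add, ← mul_add, ← Complex.ofReal_add, neg_add_cancel]
        simp
    simp only [h0, norm_zero, Real.zero_rpow hr0.ne', integral_zero]
    rw [Real.zero_rpow (by positivity)]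
    positivity
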